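/- arXiv:1604.06878 — 3 statements merged into one kernel-verified Lean document; each statement's English description precedes it below -/
import Mathlib

section
/- For each pair (2n,d) in {(34,8),(42,10),(44,10),(58,12)}, there exists a double circulant even binary code of length 2n and dimension n which is not self-dual and has minimum weight d, while every self-dual binary code of length 2n has minimum weight strictly less than d. -/
/-- The (Hamming) weight of a vector over `ZMod 2`. -/
def wt {ι : Type*} [Fintype ι] (x : ι → ZMod 2) : ℕ :=
  (Finset.univ.filter fun i => x i ≠ 0).card

/-- The dual code of a binary linear code. -/
def dualCode {ι : Type*} [Fintype ι] (C : Submodule (ZMod 2) (ι → ZMod 2)) :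
    Submodule (ZMod 2) (ι → ZMod 2) where
  carrier := {x | ∀ c ∈ C, ∑ i, x i * c i = 0}
  zero_mem' := by intro c _; simp
  add_mem' := by
    intro a b ha hb c hc
    simp only [Set.mem_setOf_eq] at ha hb ⊢
    simp [Pi.add_apply, add_mul, Finset.sum_add_distrib, ha c hc, hb c hc]
  smul_mem' := by
    intro r a ha c hc
    simp only [Set.mem_setOf_eq] at ha ⊢
    simp [Pi.smul_apply, smul_eq_mul, mul_assoc, ← Finset.mul_sum, ha c hc]

/-- A binary linear code is self-dual if it equals its dual. -/
def IsSelfDual {ι : Type*} [Fintype ι] (C : Submodule (ZMod 2) (ι → ZMod 2)) : Prop :=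
  C = dualCode C

/-- A binary code is even if every codeword has even weight. -/
def IsEvenCode {ι : Type*} [Fintype ι] (C : Submodule (ZMod 2) (ι → ZMod 2)) : Prop :=
  ∀ c ∈ C, 2 ∣ wt c

/-- `C` has minimum weight `d`: some nonzero codeword has weight `d` and
no nonzero codeword has smaller weight. -/
def HasMinWt {ι : Type*} [Fintype ι] (C : Submodule (ZMod 2) (ι → ZMod 2)) (d : ℕ) : Prop :=
  (∃ c ∈ C, c ≠ 0 ∧ wt c = d) ∧ ∀ c ∈ C, c ≠ 0 → d ≤ wt c

/-- `Awt C i` is the number `A_i(C)` of codewords of `C` of weight `i`. -/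
noncomputable def Awt {ι : Type*} [Fintype ι]
    (C : Submodule (ZMod 2) (ι → ZMod 2)) (i : ℕ) : ℕ :=
  Set.ncard {c ∈ (C : Set (ι → ZMod 2)) | wt c = i}

/-- `C` performs better than `C'`: the weight distribution of `C` is
lexicographically smaller than that of `C'`. -/
def LexSmaller {ι : Type*} [Fintype ι]
    (C C' : Submodule (ZMod 2) (ι → ZMod 2)) : Prop :=
  ∃ s : ℕ, (∀ i < s, Awt C i = Awt C' i) ∧ Awt C s < Awt C' s

/-- A circulant matrix: each row is the cyclic shift (by one position) of the previous one,
equivalently the matrix is invariant under simultaneously cyclically shifting rows and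
columns. -/
def IsCirculant {n : ℕ} (R : Matrix (Fin n) (Fin n) (ZMod 2)) : Prop :=
  ∀ i j k : Fin n, R (i + k) (j + k) = R i j

/-- The generator matrix `(I_n | R)`. -/
def genMat {n : ℕ} (R : Matrix (Fin n) (Fin n) (ZMod 2)) :
    Matrix (Fin n) (Fin n ⊕ Fin n) (ZMod 2) :=
  Matrix.of fun i => Sum.elim (fun j => if i = j then (1 : ZMod 2) else 0) (R i)

/-- The row space (span of the rows) of a matrix over `ZMod 2`. -/
def rowSpan {ι κ : Type*} (M : Matrix ι κ (ZMod 2)) : Submodule (ZMod 2) (κ → ZMod 2) :=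
  Submodule.span (ZMod 2) (Set.range M)

/-- The bordered matrix `B` with `B 0 0 = α`, the rest of the first row and first
column all ones, and remaining block the matrix `R'`. -/
def borderMat {m : ℕ} (α : ZMod 2) (R' : Matrix (Fin m) (Fin m) (ZMod 2)) :
    Matrix (Fin (m + 1)) (Fin (m + 1)) (ZMod 2) :=
  Matrix.of fun i j =>
    if hi : i = 0 then (if j = 0 then α else 1)
    else if hj : j = 0 then 1
    else R' (i.pred hi) (j.pred hj)

/-- `C` is a pure double circulant code of length `2n`. -/
def IsPureDC {n : ℕ} (C : Submodule (ZMod 2) (Fin n ⊕ Fin n → ZMod 2)) : Prop :=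
  ∃ R : Matrix (Fin n) (Fin n) (ZMod 2), IsCirculant R ∧ C = rowSpan (genMat R)

/-- `C` is a bordered double circulant code of length `2(m+1)`. -/
def IsBorderedDC {m : ℕ} (C : Submodule (ZMod 2) (Fin (m + 1) ⊕ Fin (m + 1) → ZMod 2)) : Prop :=
  ∃ (α : ZMod 2) (R' : Matrix (Fin m) (Fin m) (ZMod 2)),
    IsCirculant R' ∧ C = rowSpan (genMat (borderMat α R'))

/-- `C` is a double circulant code: pure or bordered. -/
def IsDC {m : ℕ} (C : Submodule (ZMod 2) (Fin (m + 1) ⊕ Fin (m + 1) → ZMod 2)) : Prop :=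
  IsPureDC C ∨ IsBorderedDC C

/-- The dual of a set of vectors. -/
def dualSet {ι : Type*} [Fintype ι] (X : Set (ι → ZMod 2)) : Set (ι → ZMod 2) :=
  {x | ∀ c ∈ X, ∑ i, x i * c i = 0}

/-- The shadow `S = C_0^⊥ \ C` of `C`, where `C_0` is the doubly even subcode. -/
def shadowSet {ι : Type*} [Fintype ι] (C : Submodule (ZMod 2) (ι → ZMod 2)) :
    Set (ι → ZMod 2) :=
  dualSet {c ∈ (C : Set (ι → ZMod 2)) | 4 ∣ wt c} \ (C : Set (ι → ZMod 2))

section WeightEnumerators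

open Finset

/-- The nontrivial sign character of `ZMod 2`. -/
def bitSign (a : ZMod 2) : ℤ := if a = 0 then 1 else -1

lemma bitSign_add : ∀ a b : ZMod 2, bitSign (a + b) = bitSign a * bitSign b := by decide

lemma bitSign_eq_one : ∀ {a : ZMod 2}, bitSign a = 1 ↔ a = 0 := by decide

lemma bitSign_eq_one_or : ∀ a : ZMod 2, bitSign a = 1 ∨ bitSign a = -1 := by decide

lemma bitSign_sum {ι : Type*} (u : Finset ι) (c : ι → ZMod 2) :
    bitSign (∑ i ∈ u, c i) = ∏ i ∈ u, bitSign (c i) := by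
  classical
  induction u using Finset.induction_on with
  | empty => simp [bitSign]
  | insert a u ha ih => rw [sum_insert ha, prod_insert ha, bitSign_add, ih]

variable {ι : Type*} [Fintype ι]

/-- The Hadamard transform of a function on subsets of the coordinates. -/
def hadamard (F : Finset ι → ℤ) (c : ι → ZMod 2) : ℤ :=
  ∑ u : Finset ι, F u * ∏ i ∈ u, bitSign (c i)

open Classical in
/-- The finite set of codewords. -/
noncomputable def words (C : Submodule (ZMod 2) (ι → ZMod 2)) : Finset (ι → ZMod 2) :=
  univ.filter (· ∈ C)

lemma mem_words {C : Submodule (ZMod 2) (ι → ZMod 2)} {c : ι → ZMod 2} :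
    c ∈ words C ↔ c ∈ C := by simp [words]

open Classical in
lemma sum_character (C : Submodule (ZMod 2) (ι → ZMod 2)) (ψ : (ι → ZMod 2) → ℤ)
    (hadd : ∀ a ∈ C, ∀ b ∈ C, ψ (a + b) = ψ a * ψ b)
    (hsign : ∀ a ∈ C, ψ a = 1 ∨ ψ a = -1) :
    ∑ c ∈ words C, ψ c = if ∀ c ∈ C, ψ c = 1 then ((words C).card : ℤ) else 0 := by
  split_ifs with h
  · rw [sum_congr rfl fun c hc => h c (mem_words.1 hc)]
    simp
  · push Not at h
    obtain ⟨a, ha, ha1⟩ := h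
    have hneg := (hsign a ha).resolve_left ha1
    have hshift : ∑ c ∈ words C, ψ c = ∑ c ∈ words C, ψ (c + a) := by
      refine (sum_bij' (fun c _ => c + a) (fun c _ => c - a) ?_ ?_ ?_ ?_ ?_).symm
      · exact fun c hc => mem_words.2 (C.add_mem (mem_words.1 hc) ha)
      · exact fun c hc => mem_words.2 (C.sub_mem (mem_words.1 hc) ha)
      · simp
      · simp
      · simp
    have : ∑ c ∈ words C, ψ (c + a) = -∑ c ∈ words C, ψ c := by
      rw [← sum_neg_distrib]
      refine sum_congr rfl fun c hc => ?_
      rw [hadd c (mem_words.1 hc) a ha, hneg]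
      ring
    linarith

open Classical in
/-- The sets `u` whose sign character agrees with `χ` on the code. -/
noncomputable def agreeing (C : Submodule (ZMod 2) (ι → ZMod 2)) (χ : (ι → ZMod 2) → ℤ) :
    Finset (Finset ι) :=
  univ.filter fun u => ∀ c ∈ C, χ c * ∏ i ∈ u, bitSign (c i) = 1

lemma sum_hadamard (C : Submodule (ZMod 2) (ι → ZMod 2)) (χ : (ι → ZMod 2) → ℤ)
    (hadd : ∀ a ∈ C, ∀ b ∈ C, χ (a + b) = χ a * χ b)
    (hsign : ∀ a ∈ C, χ a = 1 ∨ χ a = -1) (F : Finset ι → ℤ) :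
    ∑ c ∈ words C, χ c * hadamard F c = (words C).card * ∑ u ∈ agreeing C χ, F u := by
  classical
  simp only [hadamard, mul_sum]
  rw [sum_comm, agreeing, sum_filter]
  refine sum_congr rfl fun u _ => ?_
  have := sum_character C (fun c => χ c * ∏ i ∈ u, bitSign (c i)) ?_ ?_
  · rw [sum_congr rfl fun c _ => mul_left_comm (χ c) (F u) _, ← mul_sum, this]
    split_ifs <;> ring
  · intro a ha b hb
    simp only [hadd a ha b hb, Pi.add_apply, bitSign_add, prod_mul_distrib]
    ring
  · intro a ha
    simp only [← bitSign_sum]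
    rcases hsign a ha with h | h <;> rcases bitSign_eq_one_or (∑ i ∈ u, a i) with h' | h' <;>
      simp [h, h']

/-- The support of a vector. -/
def supp (c : ι → ZMod 2) : Finset ι := univ.filter fun i => c i ≠ 0

lemma sum_agreeing_one {C : Submodule (ZMod 2) (ι → ZMod 2)} (hC : IsSelfDual C)
    (F : Finset ι → ℤ) :
    ∑ u ∈ agreeing C (fun _ => 1), F u = ∑ c ∈ words C, F (supp c) := by
  classical
  have hmem : ∀ u : Finset ι, (fun i => if i ∈ u then (1 : ZMod 2) else 0) ∈ C ↔
      ∀ c ∈ C, (1 : ℤ) * ∏ i ∈ u, bitSign (c i) = 1 := by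
    intro u
    have : (fun i => if i ∈ u then (1 : ZMod 2) else 0) ∈ C ↔
        (fun i => if i ∈ u then (1 : ZMod 2) else 0) ∈ dualCode C := by
      rw [← show C = dualCode C from hC]
    rw [this]
    refine forall₂_congr fun c _ => ?_
    rw [one_mul, ← bitSign_sum, bitSign_eq_one]
    simp
  have hbit : ∀ a : ZMod 2, (if a = 0 then (0 : ZMod 2) else 1) = a := by decide
  have hsupp : ∀ c : ι → ZMod 2, (fun i => if i ∈ supp c then (1 : ZMod 2) else 0) = c := by
    intro c
    funext i
    simp [supp, hbit]
  refine sum_bij' (fun u _ i => if i ∈ u then (1 : ZMod 2) else 0) (fun c _ => supp c)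
    ?_ ?_ ?_ ?_ ?_
  · intro u hu
    rw [agreeing, mem_filter] at hu
    exact mem_words.2 ((hmem u).2 hu.2)
  · intro c hc
    rw [agreeing, mem_filter]
    refine ⟨mem_univ _, (hmem _).1 ?_⟩
    rw [hsupp]
    exact mem_words.1 hc
  · intro u _
    ext i
    simp [supp]
  · intro c _
    exact hsupp c
  · intro u _
    congr 1
    ext i
    simp [supp]

/-- The sign `(-1)^(wt c / 2)`, whose value is `1` exactly on doubly even words. -/
def halfSign (c : ι → ZMod 2) : ℤ := (-1) ^ (wt c / 2)

lemma wt_eq_sum (c : ι → ZMod 2) : wt c = ∑ i, (c i).val := by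
  rw [wt, card_filter]
  refine sum_congr rfl fun i _ => ?_
  generalize c i = a
  revert a
  decide

lemma natCast_wt (c : ι → ZMod 2) : (wt c : ZMod 2) = ∑ i, c i := by
  rw [wt_eq_sum, Nat.cast_sum]
  simp

lemma two_dvd_wt_iff (c : ι → ZMod 2) : 2 ∣ wt c ↔ ∑ i, c i = 0 := by
  rw [← natCast_wt, ZMod.natCast_eq_zero_iff]

lemma wt_add (a b : ι → ZMod 2) :
    wt (a + b) + 2 * wt (a * b) = wt a + wt b := by
  simp only [wt_eq_sum, mul_sum, ← sum_add_distrib, Pi.add_apply, Pi.mul_apply]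
  refine sum_congr rfl fun i _ => ?_
  generalize a i = p
  generalize b i = r
  revert p r
  decide

lemma IsSelfDual.sum_mul_eq_zero {C : Submodule (ZMod 2) (ι → ZMod 2)} (hC : IsSelfDual C)
    {a b : ι → ZMod 2} (ha : a ∈ C) (hb : b ∈ C) : ∑ i, a i * b i = 0 := by
  rw [hC] at ha
  exact ha b hb

lemma IsSelfDual.two_dvd_wt {C : Submodule (ZMod 2) (ι → ZMod 2)} (hC : IsSelfDual C)
    {a : ι → ZMod 2} (ha : a ∈ C) : 2 ∣ wt a := by
  rw [two_dvd_wt_iff, ← hC.sum_mul_eq_zero ha ha]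
  refine sum_congr rfl fun i _ => ?_
  generalize a i = p
  revert p
  decide

lemma IsSelfDual.halfSign_add {C : Submodule (ZMod 2) (ι → ZMod 2)} (hC : IsSelfDual C)
    {a b : ι → ZMod 2} (ha : a ∈ C) (hb : b ∈ C) :
    halfSign (a + b) = halfSign a * halfSign b := by
  obtain ⟨p, hp⟩ := hC.two_dvd_wt ha
  obtain ⟨r, hr⟩ := hC.two_dvd_wt hb
  obtain ⟨t, ht⟩ : 2 ∣ wt (a * b) := (two_dvd_wt_iff _).2 (hC.sum_mul_eq_zero ha hb)
  have h := wt_add a b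
  have hw : wt a / 2 + wt b / 2 = wt (a + b) / 2 + 2 * t := by omega
  rw [halfSign, halfSign, halfSign, ← pow_add, hw, pow_add, pow_mul]
  simp

/-- Duality bound in certificate form: a combination of MacWilliams identities for a self-dual
code and its shadow evaluates to a count of shadow vectors. -/
lemma IsSelfDual.certificate {C : Submodule (ZMod 2) (ι → ZMod 2)} (hC : IsSelfDual C)
    (F M : Finset ι → ℤ) (ν : ℤ)
    (hcert : ∀ c ∈ C, hadamard F c - (words C).card * F (supp c) + halfSign c * hadamard M c =
      if c = 0 then ν else 0) :
    ∃ S : Finset (Finset ι), ν = (words C).card * ∑ u ∈ S, M u := by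
  classical
  refine ⟨agreeing C halfSign, ?_⟩
  have hF := sum_hadamard C (fun _ => 1) (by simp) (by simp) F
  have hM := sum_hadamard C halfSign (fun a ha b hb => hC.halfSign_add ha hb)
    (fun a _ => neg_one_pow_eq_or ℤ _) M
  rw [sum_agreeing_one hC, mul_sum] at hF
  have hsum := sum_congr (rfl : words C = words C) fun c hc => hcert c (mem_words.1 hc)
  rw [sum_ite_eq' (words C) 0 fun _ => ν, if_pos (mem_words.2 C.zero_mem), sum_add_distrib,
    sum_sub_distrib, hM, ← hF] at hsum
  simpa using hsum.symm

lemma IsSelfDual.card_words_sq {C : Submodule (ZMod 2) (ι → ZMod 2)} (hC : IsSelfDual C) :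
    (words C).card ^ 2 = 2 ^ Fintype.card ι := by
  classical
  have h := sum_hadamard C (fun _ => 1) (by simp) (by simp) (fun _ => 1)
  rw [sum_agreeing_one hC] at h
  have hhat : ∀ c : ι → ZMod 2, hadamard (fun _ => 1) c =
      if c = 0 then (2 : ℤ) ^ Fintype.card ι else 0 := by
    intro c
    simp only [hadamard, one_mul]
    rw [← powerset_univ, ← prod_one_add]
    split_ifs with hc
    · simp [hc, bitSign]
    · obtain ⟨i, hi⟩ := Function.ne_iff.1 hc
      refine prod_eq_zero (mem_univ i) ?_
      rw [bitSign, if_neg (by simpa using hi)]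
      norm_num
  simp only [one_mul, hhat, sum_const] at h
  rw [sum_ite_eq' (words C) 0 fun _ => _, if_pos (mem_words.2 C.zero_mem)] at h
  have : ((words C).card : ℤ) ^ 2 = 2 ^ Fintype.card ι := by
    rw [h]; simp [sq]
  exact_mod_cast this

end WeightEnumerators

section NumericalCertificates

open Finset

/-- The operator `g ↦ (j ↦ g j + s * g (j + 1))`. -/
def addShift (s : ℤ) (g : ℕ → ℤ) : ℕ → ℤ := fun j => g j + s * g (j + 1)

lemma addShift_commute (s t : ℤ) : Function.Commute (addShift s) (addShift t) := by
  intro g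
  funext j
  simp only [addShift]
  ring

lemma sum_powerset_bitSign {ι : Type*} (T : Finset ι) (c : ι → ZMod 2) (g : ℕ → ℤ) :
    ∑ u ∈ T.powerset, g u.card * ∏ i ∈ u, bitSign (c i) =
      ((addShift (-1))^[(T.filter fun i => c i ≠ 0).card]
        ((addShift 1)^[(T.filter fun i => c i = 0).card] g)) 0 := by
  classical
  induction T using Finset.induction_on generalizing g with
  | empty => simp
  | insert a T ha ih =>
    have hstep : ∑ u ∈ (insert a T).powerset, g u.card * ∏ i ∈ u, bitSign (c i) =
        ∑ u ∈ T.powerset, addShift (bitSign (c a)) g u.card * ∏ i ∈ u, bitSign (c i) := by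
      rw [sum_powerset_insert ha, ← sum_add_distrib]
      refine sum_congr rfl fun u hu => ?_
      have hau : a ∉ u := fun h => ha (mem_powerset.1 hu h)
      rw [card_insert_of_notMem hau, prod_insert hau, addShift]
      ring
    rw [hstep, ih]
    by_cases h : c a = 0
    · rw [filter_insert, filter_insert, if_neg (by simpa using h), if_pos h,
        card_insert_of_notMem (by simp [ha]), Function.iterate_succ_apply, bitSign, if_pos h]
    · rw [filter_insert, filter_insert, if_pos h, if_neg h,
        card_insert_of_notMem (by simp [ha]), Function.iterate_succ_apply, bitSign, if_neg h,
        ((addShift_commute (-1) 1).symm.iterate_left _).eq]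

/-- `addShift` on finitely supported sequences stored as lists. -/
def listShift (s : ℤ) : List ℤ → List ℤ
  | [] => []
  | [a] => [a]
  | a :: b :: l => (a + s * b) :: listShift s (b :: l)

lemma getD_listShift (s : ℤ) (l : List ℤ) :
    (fun j => (listShift s l).getD j 0) = addShift s fun j => l.getD j 0 := by
  funext j
  simp only [addShift]
  induction l using listShift.induct generalizing j with
  | case1 => simp [listShift]
  | case2 a => cases j <;> simp [listShift]
  | case3 a b l ih =>
    cases j with
    | zero => simp [listShift]
    | succ j => simpa [listShift] using ih j

lemma getD_iterate_listShift (s : ℤ) (k : ℕ) (l : List ℤ) :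
    (fun j => ((listShift s)^[k] l).getD j 0) = (addShift s)^[k] fun j => l.getD j 0 := by
  induction k generalizing l with
  | zero => rfl
  | succ k ih => rw [Function.iterate_succ_apply, ih, getD_listShift, Function.iterate_succ_apply]

lemma getD_zipWith_add_mul (s : ℤ) (l₀ l₁ : List ℤ) (h : l₀.length = l₁.length) (j : ℕ) :
    (List.zipWith (fun a b => a + s * b) l₀ l₁).getD j 0 = l₀.getD j 0 + s * l₁.getD j 0 := by
  induction l₀ generalizing l₁ j with
  | nil => cases l₁ <;> simp_all
  | cons a l₀ ih =>
    cases l₁ with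
    | nil => simp at h
    | cons b l₁ =>
      cases j with
      | zero => simp
      | succ j => simpa using ih l₁ (by simpa using h) j

/-- A function on subsets of the coordinates depending only on membership of `x` and on the
number of other elements. -/
def splitFun {ι : Type*} [DecidableEq ι] (x : ι) (l₀ l₁ : List ℤ) (u : Finset ι) : ℤ :=
  if x ∈ u then l₁.getD (u.card - 1) 0 else l₀.getD u.card 0

/-- The Hadamard transform of `splitFun x l₀ l₁` at a word with coordinate sign `s` at `x`, and
`a` nonzero and `b` zero coordinates elsewhere. -/
def splitTransform (l₀ l₁ : List ℤ) (s : ℤ) (a b : ℕ) : ℤ :=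
  ((listShift (-1))^[a] ((listShift 1)^[b] (List.zipWith (fun p r => p + s * r) l₀ l₁))).getD 0 0

lemma hadamard_splitFun {ι : Type*} [Fintype ι] [DecidableEq ι] (x : ι) (l₀ l₁ : List ℤ)
    (h : l₀.length = l₁.length) (c : ι → ZMod 2) :
    hadamard (splitFun x l₀ l₁) c = splitTransform l₀ l₁ (bitSign (c x))
      ((univ.erase x).filter fun i => c i ≠ 0).card
      ((univ.erase x).filter fun i => c i = 0).card := by
  have key := sum_powerset_bitSign (univ.erase x) c
    fun j => (List.zipWith (fun p r => p + bitSign (c x) * r) l₀ l₁).getD j 0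
  rw [← getD_iterate_listShift, ← getD_iterate_listShift] at key
  refine Eq.trans ?_ key
  rw [hadamard, ← powerset_univ, ← insert_erase (mem_univ x), sum_powerset_insert (by simp),
    ← sum_add_distrib, insert_erase (mem_univ x)]
  refine sum_congr rfl fun u hu => ?_
  have hxu : x ∉ u := fun h => by simpa using mem_powerset.1 hu h
  rw [getD_zipWith_add_mul _ _ _ h, splitFun, splitFun, if_neg hxu, if_pos (mem_insert_self x u),
    card_insert_of_notMem hxu, prod_insert hxu, Nat.add_sub_cancel]
  ring

/-- The verification, weight by weight, of the hypothesis of `IsSelfDual.certificate`. -/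
def certificateHolds (n d : ℕ) (q ν : ℤ) (g₀ g₁ m₀ m₁ : List ℤ) : Bool :=
  (List.range n).all fun a => [0, 1].all fun e =>
    let w := e + a
    let s : ℤ := if e = 0 then 1 else -1
    (w % 2 == 1) || (!(w == 0) && Nat.blt w d) ||
      decide (splitTransform g₀ g₁ s a (n - 1 - a) -
        q * (if e = 0 then g₀ else g₁).getD a 0 +
        (if w % 4 = 0 then 1 else -1) * splitTransform m₀ m₁ s a (n - 1 - a) =
        if w = 0 then ν else 0)

lemma IsSelfDual.exists_sum_eq {m : ℕ}
    {C : Submodule (ZMod 2) (Fin (m + 1) ⊕ Fin (m + 1) → ZMod 2)} (hC : IsSelfDual C) {d : ℕ}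
    (hd : ∀ c ∈ C, c ≠ 0 → d ≤ wt c) (ν : ℤ) (g₀ g₁ m₀ m₁ : List ℤ)
    (hg : g₀.length = g₁.length) (hm : m₀.length = m₁.length)
    (h : certificateHolds (2 * (m + 1)) d (2 ^ (m + 1)) (2 ^ (m + 1) * ν) g₀ g₁ m₀ m₁ = true) :
    ∃ S : Finset (Finset (Fin (m + 1) ⊕ Fin (m + 1))),
      ν = ∑ u ∈ S, splitFun (Sum.inl 0) m₀ m₁ u := by
  have hcard : (words C).card = 2 ^ (m + 1) := by
    have := hC.card_words_sq
    rw [Fintype.card_sum, Fintype.card_fin, ← two_mul, mul_comm, pow_mul] at this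
    exact Nat.pow_left_injective two_ne_zero this
  have hcardZ : ((words C).card : ℤ) = 2 ^ (m + 1) := by rw [hcard]; simp
  set x : Fin (m + 1) ⊕ Fin (m + 1) := Sum.inl 0
  suffices hcert : ∀ c ∈ C, hadamard (splitFun x g₀ g₁) c -
      (words C).card * splitFun x g₀ g₁ (supp c) + halfSign c * hadamard (splitFun x m₀ m₁) c =
        if c = 0 then 2 ^ (m + 1) * ν else 0 by
    obtain ⟨S, hS⟩ := hC.certificate _ _ _ hcert
    exact ⟨S, mul_left_cancel₀ (pow_ne_zero (m + 1) (two_ne_zero' ℤ)) (by rw [hS, hcardZ])⟩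
  intro c hc
  rw [hcardZ, hadamard_splitFun x _ _ hg, hadamard_splitFun x _ _ hm]
  set a := ((univ.erase x).filter fun i => c i ≠ 0).card with ha
  have hab : a + ((univ.erase x).filter fun i => c i = 0).card = 2 * (m + 1) - 1 := by
    rw [ha, add_comm, card_filter_add_card_filter_not, card_erase_of_mem (mem_univ x), card_univ,
      Fintype.card_sum, Fintype.card_fin, two_mul]
  have hsupp : (supp c).card = wt c := rfl
  obtain ⟨e, he, hw, hsg, hF⟩ : ∃ e : ℕ, (e = 0 ∨ e = 1) ∧ wt c = e + a ∧
      bitSign (c x) = (if e = 0 then 1 else -1) ∧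
      splitFun x g₀ g₁ (supp c) = (if e = 0 then g₀ else g₁).getD a 0 := by
    have hwt : wt c = (if c x ≠ 0 then 1 else 0) + a := by
      rw [wt, ← insert_erase (mem_univ x), filter_insert]
      split_ifs with hx
      · rw [card_insert_of_notMem (by simp), add_comm]
      · rw [zero_add]
    by_cases hx : c x = 0
    · refine ⟨0, Or.inl rfl, by simpa [hx] using hwt, by simp [bitSign, hx], ?_⟩
      simp [splitFun, supp, hx, ← hsupp] at hwt ⊢
      rw [hwt]
    · refine ⟨1, Or.inr rfl, by simpa [hx] using hwt, by simp [bitSign, hx], ?_⟩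
      simp [splitFun, supp, hx, ← hsupp] at hwt ⊢
      rw [hwt]
      simp
  have hlt : a < 2 * (m + 1) := by omega
  rw [certificateHolds, List.all_eq_true] at h
  have h₁ := h a (List.mem_range.2 hlt)
  rw [List.all_eq_true] at h₁
  have h₂ := h₁ e (by rcases he with rfl | rfl <;> simp)
  obtain ⟨k, hk⟩ := hC.two_dvd_wt hc
  have hzero : c = 0 ↔ e + a = 0 := by
    rw [← hw, wt, card_eq_zero, filter_eq_empty_iff]
    simp [funext_iff]
  have hhalf : halfSign c = if (e + a) % 4 = 0 then 1 else -1 := by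
    rw [halfSign, ← hw, hk, Nat.mul_div_cancel_left _ two_pos]
    split_ifs with h4
    · exact Even.neg_one_pow (Nat.even_iff.2 (by omega))
    · exact Odd.neg_one_pow (Nat.odd_iff.2 (by omega))
  have hodd : ¬ (e + a) % 2 = 1 := by omega
  have hsmall : ¬ (e + a ≠ 0 ∧ e + a < d) := by
    rintro ⟨h0, hlt'⟩
    have := hd c hc (fun h => h0 (hzero.1 h))
    omega
  have hb : ((univ.erase x).filter fun i => c i = 0).card = 2 * (m + 1) - 1 - a := by omega
  simp only [Bool.or_eq_true, beq_iff_eq, Bool.and_eq_true, Bool.not_eq_true', beq_eq_false_iff_ne,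
    Nat.blt_eq, decide_eq_true_eq, hodd, hsmall, false_or] at h₂
  rw [hb, hsg, hF, hhalf, h₂]
  simp only [hzero]

end NumericalCertificates

section CirculantSearch

open Finset

/-- The base-64 encoding of a binary vector: addition becomes `xor`, and the weight is the residue
modulo 63. -/
def encode {n : ℕ} (x : Fin n → ZMod 2) : ℕ := ∑ i, (x i).val * 64 ^ (i : ℕ)

lemma encode_succ {n : ℕ} (x : Fin (n + 1) → ZMod 2) :
    encode x = (x 0).val + 2 ^ 6 * encode fun i => x i.succ := by
  rw [encode, Fin.sum_univ_succ, encode, mul_sum]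
  congr 1
  · simp
  · refine sum_congr rfl fun i _ => ?_
    rw [Fin.val_succ, pow_succ]
    ring

lemma add_two_pow_mul_xor {k a b : ℕ} (p r : ℕ) (ha : a < 2 ^ k) (hb : b < 2 ^ k) :
    (a + 2 ^ k * p) ^^^ (b + 2 ^ k * r) = (a ^^^ b) + 2 ^ k * (p ^^^ r) := by
  have hab := Nat.xor_lt_two_pow ha hb
  rw [← Nat.mod_add_div ((a + 2 ^ k * p) ^^^ (b + 2 ^ k * r)) (2 ^ k), Nat.xor_mod_two_pow,
    Nat.xor_div_two_pow]
  simp [Nat.add_mul_div_left, Nat.div_eq_of_lt, Nat.mod_eq_of_lt, ha, hb]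

lemma encode_add {n : ℕ} (x y : Fin n → ZMod 2) : encode (x + y) = encode x ^^^ encode y := by
  induction n with
  | zero => simp [encode]
  | succ n ih =>
    have hlt : ∀ a : ZMod 2, a.val < 2 ^ 6 := by decide
    have hval : ∀ a b : ZMod 2, (a + b).val = a.val ^^^ b.val := by decide
    rw [encode_succ, encode_succ x, encode_succ y, add_two_pow_mul_xor _ _ (hlt _) (hlt _), ← ih,
      Pi.add_apply, hval]
    rfl

lemma wt_le {n : ℕ} (x : Fin n → ZMod 2) : wt x ≤ n :=
  (card_filter_le _ _).trans_eq (by simp)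

lemma encode_mod {n : ℕ} (hn : n < 63) (x : Fin n → ZMod 2) : encode x % 63 = wt x := by
  have h : encode x ≡ wt x [MOD 63] := by
    rw [encode, wt_eq_sum]
    refine Nat.ModEq.sum fun i _ => ?_
    simpa using (Nat.ModEq.pow i (show 64 ≡ 1 [MOD 63] by decide)).mul_left (x i).val
  rw [h, Nat.mod_eq_of_lt ((wt_le x).trans_lt hn)]

/-- Check that adding at most `k` of the encoded `rows` to the encoded vector `acc` leaves a vector
whose weight, increased by `w` and by the number of rows used, is at least `d`. -/
def searchRows (d : ℕ) : List ℕ → ℕ → ℕ → ℕ → Bool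
  | [], _, w, acc => Nat.ble d (w + acc % 63)
  | _ :: _, 0, w, acc => Nat.ble d (w + acc % 63)
  | r :: rows, k + 1, w, acc =>
    searchRows d rows (k + 1) w acc && searchRows d rows k (w + 1) (acc ^^^ r)

lemma le_of_searchRows {n : ℕ} (hn : n < 63) (d : ℕ) (rows : List (Fin n → ZMod 2)) (k w : ℕ)
    (v : Fin n → ZMod 2) (h : searchRows d (rows.map encode) k w (encode v) = true)
    (t : List (Fin n → ZMod 2)) (ht : t.Sublist rows) (hk : t.length ≤ k) :
    d ≤ w + t.length + wt (v + t.sum) := by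
  have hleaf : ∀ (w : ℕ) (v : Fin n → ZMod 2),
      Nat.ble d (w + encode v % 63) = true → d ≤ w + wt v := by
    intro w v
    rw [encode_mod hn, Nat.ble_eq]
    exact id
  induction rows generalizing k w v t with
  | nil =>
    rw [List.sublist_nil.1 ht]
    simpa using hleaf _ _ h
  | cons r rows ih =>
    cases k with
    | zero =>
      rw [List.length_eq_zero_iff.1 (Nat.le_zero.1 hk)]
      simpa using hleaf _ _ h
    | succ k =>
      rw [List.map_cons, searchRows, Bool.and_eq_true, ← encode_add] at h
      rcases List.sublist_cons_iff.1 ht with ht' | ⟨t, rfl, ht'⟩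
      · exact ih _ _ _ h.1 t ht' hk
      · have := ih _ _ _ h.2 t ht' (by simpa using hk)
        rw [List.sum_cons, List.length_cons, ← add_assoc v]
        omega

/-- Row-by-row search through the nonzero combinations of at most `k + 1` rows of a circulant
matrix, up to cyclic shifts. -/
def searchCirculant {m : ℕ} (d k : ℕ) (v : Fin (m + 1) → ZMod 2) : Bool :=
  searchRows d ((List.finRange m).map fun i => encode (Matrix.circulant v i.succ)) k 1
    (encode (Matrix.circulant v 0))

lemma wt_comp_equiv {ι κ : Type*} [Fintype ι] [Fintype κ] (e : κ ≃ ι) (x : ι → ZMod 2) :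
    wt (fun i => x (e i)) = wt x := by
  rw [wt_eq_sum, wt_eq_sum, e.sum_comp fun i => (x i).val]

lemma vecMul_circulant_shift {n : ℕ} [NeZero n] (v x : Fin n → ZMod 2) (i : Fin n) :
    Matrix.vecMul (fun j => x (j + i)) (Matrix.circulant v) =
      fun j => Matrix.vecMul x (Matrix.circulant v) (j + i) := by
  funext j
  simp only [Matrix.vecMul, dotProduct, Matrix.circulant_apply]
  rw [← Equiv.sum_comp (Equiv.addRight i) fun p => x p * v (p - (j + i))]
  simp [add_sub_add_right_eq_sub]

lemma le_of_searchCirculant {m : ℕ} (hm : m + 1 < 63) {d k : ℕ} {v : Fin (m + 1) → ZMod 2}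
    (h : searchCirculant d k v = true) {x : Fin (m + 1) → ZMod 2} (hx : x ≠ 0)
    (hk : wt x ≤ k + 1) : d ≤ wt x + wt (Matrix.vecMul x (Matrix.circulant v)) := by
  wlog hx0 : x 0 ≠ 0 generalizing x
  · obtain ⟨i, hi⟩ := Function.ne_iff.1 hx
    have hwt := wt_comp_equiv (Equiv.addRight i) x
    have hwt' := wt_comp_equiv (Equiv.addRight i) (Matrix.vecMul x (Matrix.circulant v))
    simp only [Equiv.coe_addRight] at hwt hwt'
    have := this (x := fun j => x (j + i)) (Function.ne_iff.2 ⟨0, by simpa using hi⟩)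
      (by rwa [hwt]) (by simpa using hi)
    rwa [vecMul_circulant_shift, hwt, hwt'] at this
  set t : List (Fin m) := (List.finRange m).filter fun i => x i.succ ≠ 0 with ht
  have hlen : wt x = 1 + t.length := by
    rw [wt, card_filter, Fin.sum_univ_succ, if_pos hx0, ← card_filter, ht]
    congr 1
  have hbit : ∀ a : ZMod 2, a ≠ 0 → a = 1 := by decide
  have hmul : Matrix.vecMul x (Matrix.circulant v) = Matrix.circulant v 0 +
      (t.map fun i => Matrix.circulant v i.succ).sum := by
    rw [Matrix.vecMul_eq_sum, Fin.sum_univ_succ, hbit _ hx0, one_smul]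
    congr 1
    rw [ht, ← List.sum_toFinset _ ((List.nodup_finRange m).filter _), List.toFinset_filter,
      List.toFinset_finRange, sum_filter]
    refine sum_congr rfl fun i _ => ?_
    by_cases hi : x i.succ = 0
    · simp [hi]
    · simp [hbit _ hi]
  rw [searchCirculant] at h
  have := le_of_searchRows hm d ((List.finRange m).map fun i => Matrix.circulant v i.succ) k 1
    (Matrix.circulant v 0) (by rwa [List.map_map]) (t.map fun i => Matrix.circulant v i.succ)
    (List.filter_sublist.map _) (by rw [List.length_map]; omega)
  rwa [List.length_map, ← hmul, ← hlen] at this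

/-- The vector of length `n` whose coordinates are the binary digits of `N`. -/
def bitVector (n N : ℕ) : Fin n → ZMod 2 := fun i => if N.testBit i then 1 else 0

end CirculantSearch

section DoubleCirculant

open Finset

lemma rowSpan_eq_range {ι κ : Type*} [Fintype ι] (M : Matrix ι κ (ZMod 2)) :
    rowSpan M = LinearMap.range M.vecMulLinear := by
  rw [range_vecMulLinear]
  rfl

lemma vecMul_genMat {n : ℕ} (R : Matrix (Fin n) (Fin n) (ZMod 2)) (x : Fin n → ZMod 2) :
    Matrix.vecMul x (genMat R) = Sum.elim x (Matrix.vecMul x R) := by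
  funext j
  rcases j with j | j <;> simp [Matrix.vecMul, dotProduct, genMat]

lemma mem_rowSpan_genMat {n : ℕ} {R : Matrix (Fin n) (Fin n) (ZMod 2)}
    {c : Fin n ⊕ Fin n → ZMod 2} :
    c ∈ rowSpan (genMat R) ↔ ∃ x, Sum.elim x (Matrix.vecMul x R) = c := by
  simp [rowSpan_eq_range, vecMul_genMat]

lemma finrank_rowSpan_genMat {n : ℕ} (R : Matrix (Fin n) (Fin n) (ZMod 2)) :
    Module.finrank (ZMod 2) (rowSpan (genMat R)) = n := by
  rw [rowSpan_eq_range, LinearMap.finrank_range_of_inj]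
  · simp
  · intro x y h
    simp only [Matrix.vecMulLinear_apply, vecMul_genMat] at h
    funext i
    simpa using congrFun h (Sum.inl i)

lemma wt_sumElim {ι κ : Type*} [Fintype ι] [Fintype κ] (x : ι → ZMod 2) (y : κ → ZMod 2) :
    wt (Sum.elim x y) = wt x + wt y := by
  simp [wt_eq_sum]

/-- An even double circulant code that is not self-dual, from an invertible circulant matrix with
odd rows; only combinations of few rows of the matrix and of its inverse have to be searched. -/
lemma exists_doubleCirculant {m : ℕ} (hm : m + 1 < 63) (k : ℕ) (v w : Fin (m + 1) → ZMod 2)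
    (hvw : ∀ i, ∑ j, v (i - j) * w j = if i = 0 then 1 else 0)
    (hwt : wt v = 2 * k + 3)
    (hv : searchCirculant (2 * k + 4) k v = true) (hw : searchCirculant (2 * k + 4) k w = true)
    (hsd : ∃ i ≠ 0, ∑ j, v (i - j) * v (0 - j) ≠ 0) :
    ∃ C : Submodule (ZMod 2) (Fin (m + 1) ⊕ Fin (m + 1) → ZMod 2),
      IsDC C ∧ IsEvenCode C ∧ ¬ IsSelfDual C ∧
      Module.finrank (ZMod 2) C = m + 1 ∧ HasMinWt C (2 * k + 4) := by
  set R := Matrix.circulant v with hR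
  have hinv : R * Matrix.circulant w = 1 := by
    rw [hR, Matrix.circulant_mul, ← Matrix.circulant_single_one]
    congr 1
    funext i
    simp [Matrix.mulVec, dotProduct, hvw, Pi.single_apply]
  have hrow : ∀ i, ∑ j, R i j = 1 := by
    intro i
    have h₁ : ∑ j, v j = 1 := by
      rw [← natCast_wt, hwt]
      push_cast
      rw [show (2 : ZMod 2) = 0 by decide, show (3 : ZMod 2) = 1 by decide]
      simp
    rw [← h₁, ← (Equiv.subLeft i).sum_comp v]
    rfl
  have hrow_mem : ∀ i, Sum.elim (Pi.single i 1) (R i) ∈ rowSpan (genMat R) := fun i =>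
    mem_rowSpan_genMat.2 ⟨Pi.single i 1, by rw [Matrix.single_one_vecMul]; rfl⟩
  have heven : IsEvenCode (rowSpan (genMat R)) := by
    intro c hc
    obtain ⟨x, rfl⟩ := mem_rowSpan_genMat.1 hc
    rw [two_dvd_wt_iff, Fintype.sum_sum_type]
    simp only [Sum.elim_inl, Sum.elim_inr, Matrix.vecMul, dotProduct]
    rw [sum_comm]
    simp only [← mul_sum, hrow, mul_one]
    exact CharTwo.add_self_eq_zero _
  refine ⟨rowSpan (genMat R), Or.inl ⟨R, fun i j k => by simp [hR], rfl⟩, heven, ?_,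
    finrank_rowSpan_genMat R, ⟨_, hrow_mem 0, ?_, ?_⟩, ?_⟩
  · intro hself
    obtain ⟨i, hi, hne⟩ := hsd
    refine hne ?_
    have := hself.sum_mul_eq_zero (hrow_mem i) (hrow_mem 0)
    simpa [Fintype.sum_sum_type, Pi.single_apply, hi.symm, hR] using this
  · intro h
    simpa using congrFun h (Sum.inl 0)
  · have h₀ : wt (R 0) = wt v := wt_comp_equiv (Equiv.subLeft (0 : Fin (m + 1))) v
    have h₁ : wt (Pi.single (0 : Fin (m + 1)) (1 : ZMod 2)) = 1 := by
      simp [wt_eq_sum, Pi.single_apply, apply_ite ZMod.val]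
      rfl
    rw [wt_sumElim, h₀, h₁, hwt]
    ring
  · intro c hc hc0
    obtain ⟨p, hp⟩ := heven c hc
    obtain ⟨x, rfl⟩ := mem_rowSpan_genMat.1 hc
    have hx : x ≠ 0 := by
      rintro rfl
      exact hc0 (by simp)
    have hback : Matrix.vecMul (Matrix.vecMul x R) (Matrix.circulant w) = x := by
      rw [Matrix.vecMul_vecMul, hinv, Matrix.vecMul_one]
    rw [wt_sumElim] at hp ⊢
    by_cases h₁ : wt x ≤ k + 1
    · exact le_of_searchCirculant hm hv hx h₁
    · by_cases h₂ : wt (Matrix.vecMul x R) ≤ k + 1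
      · have hy : Matrix.vecMul x R ≠ 0 := by
          intro h
          rw [h, Matrix.zero_vecMul] at hback
          exact hx hback.symm
        have := le_of_searchCirculant hm hw hy h₂
        rw [hback] at this
        omega
      · omega

end DoubleCirculant

section ExtremalLengths

open Finset

lemma splitFun_induction {ι : Type*} [DecidableEq ι] {P : ℤ → Prop} (h0 : P 0) {l₀ l₁ : List ℤ}
    (h₀ : ∀ a ∈ l₀, P a) (h₁ : ∀ a ∈ l₁, P a) (x : ι) (u : Finset ι) : P (splitFun x l₀ l₁ u) := by
  have hgetD : ∀ l : List ℤ, (∀ a ∈ l, P a) → ∀ j, P (l.getD j 0) := by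
    intro l hl j
    rw [List.getD_eq_getElem?_getD]
    cases hj : l[j]? with
    | none => exact h0
    | some a => exact hl a (List.mem_of_getElem? hj)
  rw [splitFun]
  split_ifs
  exacts [hgetD l₁ h₁ _, hgetD l₀ h₀ _]

lemma exists_doubleCirculant_34 :
    ∃ C : Submodule (ZMod 2) (Fin (16 + 1) ⊕ Fin (16 + 1) → ZMod 2),
      IsDC C ∧ IsEvenCode C ∧ ¬ IsSelfDual C ∧
      Module.finrank (ZMod 2) C = 16 + 1 ∧ HasMinWt C 8 :=
  exists_doubleCirculant (by norm_num) 2 (bitVector _ 20889) (bitVector _ 74456)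
    (by decide +kernel) (by decide +kernel) (by decide +kernel) (by decide +kernel)
    (by decide +kernel)

set_option maxRecDepth 100000 in
lemma not_isSelfDual_34 {C : Submodule (ZMod 2) (Fin (16 + 1) ⊕ Fin (16 + 1) → ZMod 2)}
    (hd : ∀ c ∈ C, c ≠ 0 → 8 ≤ wt c) : ¬ IsSelfDual C := by
  intro hC
  obtain ⟨S, hS⟩ := hC.exists_sum_eq hd 40
    [-30, 0, 6, 0, -3, 0, 3, 0, 0, 0, 0, 0, 0, 0, 0, 0, 0, 0, 0, 0, 0, 0, 0, 0, 0, 0, 0, 0, 3, 0,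
     5, 0, 22, 0]
    [0, -66, 0, -15, 0, -9, 0, 0, 0, 0, 0, 0, 0, 0, 0, 0, 0, 0, 0, 0, 0, 0, 0, 0, 0, 0, 0, -1, 0,
     1, 0, -2, 0, 10]
    [0, 16, 0, 0, 0, 0]
    [112, 0, 0, 0, 16, 0]
    rfl rfl (by decide +kernel)
  have : (16 : ℤ) ∣ 40 := by
    rw [hS]
    exact dvd_sum fun u _ => splitFun_induction (P := fun a => (16 : ℤ) ∣ a)
      (dvd_zero _) (by decide) (by decide) _ u
  exact absurd this (by decide)

lemma exists_doubleCirculant_42 :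
    ∃ C : Submodule (ZMod 2) (Fin (20 + 1) ⊕ Fin (20 + 1) → ZMod 2),
      IsDC C ∧ IsEvenCode C ∧ ¬ IsSelfDual C ∧
      Module.finrank (ZMod 2) C = 20 + 1 ∧ HasMinWt C 10 :=
  exists_doubleCirculant (by norm_num) 3 (bitVector _ 1172753) (bitVector _ 1862303)
    (by decide +kernel) (by decide +kernel) (by decide +kernel) (by decide +kernel)
    (by decide +kernel)

set_option maxRecDepth 100000 in
lemma not_isSelfDual_42 {C : Submodule (ZMod 2) (Fin (20 + 1) ⊕ Fin (20 + 1) → ZMod 2)}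
    (hd : ∀ c ∈ C, c ≠ 0 → 10 ≤ wt c) : ¬ IsSelfDual C := by
  intro hC
  obtain ⟨S, hS⟩ := hC.exists_sum_eq hd (-336)
    [252, 0, 123, 0, 15, 0, 9, 0, -3, 0, 0, 0, 0, 0, 0, 0, 0, 0, 0, 0, 0, 0, 0, 0, 0, 0, 0, 0, 0,
     0, 0, 0, 0, 0, 1, 0, -3, 0, -5, 0, -41, 0]
    [0, 123, 0, 15, 0, 9, 0, -3, 0, 0, 0, 0, 0, 0, 0, 0, 0, 0, 0, 0, 0, 0, 0, 0, 0, 0, 0, 0, 0, 0,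
     0, 0, 0, 1, 0, -3, 0, -5, 0, -41, 0, -84]
    [0, 320, 0, 0, 0, 32]
    [320, 0, 0, 0, 32, 0]
    rfl rfl (by decide +kernel)
  have : (0 : ℤ) ≤ -336 := by
    rw [hS]
    exact sum_nonneg fun u _ => splitFun_induction (P := fun a => (0 : ℤ) ≤ a)
      le_rfl (by decide) (by decide) _ u
  exact absurd this (by decide)

lemma exists_doubleCirculant_44 :
    ∃ C : Submodule (ZMod 2) (Fin (21 + 1) ⊕ Fin (21 + 1) → ZMod 2),
      IsDC C ∧ IsEvenCode C ∧ ¬ IsSelfDual C ∧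
      Module.finrank (ZMod 2) C = 21 + 1 ∧ HasMinWt C 10 :=
  exists_doubleCirculant (by norm_num) 3 (bitVector _ 836123) (bitVector _ 1063649)
    (by decide +kernel) (by decide +kernel) (by decide +kernel) (by decide +kernel)
    (by decide +kernel)

set_option maxRecDepth 100000 in
lemma not_isSelfDual_44 {C : Submodule (ZMod 2) (Fin (21 + 1) ⊕ Fin (21 + 1) → ZMod 2)}
    (hd : ∀ c ∈ C, c ≠ 0 → 10 ≤ wt c) : ¬ IsSelfDual C := by
  intro hC
  obtain ⟨S, hS⟩ := hC.exists_sum_eq hd (-176)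
    [132, 0, 120, 0, 3, 0, 12, 0, -3, 0, 0, 0, 0, 0, 0, 0, 0, 0, 0, 0, 0, 0, 0, 0, 0, 0, 0, 0, 0,
     0, 0, 0, 0, 0, 0, 0, 1, 0, -4, 0, -1, 0, -40, 0]
    [0, 120, 0, 3, 0, 12, 0, -3, 0, 0, 0, 0, 0, 0, 0, 0, 0, 0, 0, 0, 0, 0, 0, 0, 0, 0, 0, 0, 0, 0,
     0, 0, 0, 0, 0, 1, 0, -4, 0, -1, 0, -40, 0, -44]
    [0, 0, 160, 0, 0, 0, 16]
    [0, 160, 0, 0, 0, 16, 0]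
    rfl rfl (by decide +kernel)
  have : (0 : ℤ) ≤ -176 := by
    rw [hS]
    exact sum_nonneg fun u _ => splitFun_induction (P := fun a => (0 : ℤ) ≤ a)
      le_rfl (by decide) (by decide) _ u
  exact absurd this (by decide)

lemma exists_doubleCirculant_58 :
    ∃ C : Submodule (ZMod 2) (Fin (28 + 1) ⊕ Fin (28 + 1) → ZMod 2),
      IsDC C ∧ IsEvenCode C ∧ ¬ IsSelfDual C ∧
      Module.finrank (ZMod 2) C = 28 + 1 ∧ HasMinWt C 12 :=
  exists_doubleCirculant (by norm_num) 4 (bitVector _ 1454875) (bitVector _ 96935998)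
    (by decide +kernel) (by decide +kernel) (by decide +kernel) (by decide +kernel)
    (by decide +kernel)

set_option maxRecDepth 100000 in
lemma not_isSelfDual_58 {C : Submodule (ZMod 2) (Fin (28 + 1) ⊕ Fin (28 + 1) → ZMod 2)}
    (hd : ∀ c ∈ C, c ≠ 0 → 12 ≤ wt c) : ¬ IsSelfDual C := by
  intro hC
  obtain ⟨S, hS⟩ := hC.exists_sum_eq hd 1276
    [-957, 0, 33, 0, -162, 0, 18, 0, -15, 0, 3, 0, 0, 0, 0, 0, 0, 0, 0, 0, 0, 0, 0, 0, 0, 0, 0, 0,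
     0, 0, 0, 0, 0, 0, 0, 0, 0, 0, 0, 0, 0, 0, 0, 0, 0, 0, 0, 0, -1, 0, 5, 0, -6, 0, 54, 0, -11, 0]
    [0, 33, 0, -162, 0, 18, 0, -15, 0, 3, 0, 0, 0, 0, 0, 0, 0, 0, 0, 0, 0, 0, 0, 0, 0, 0, 0, 0, 0,
     0, 0, 0, 0, 0, 0, 0, 0, 0, 0, 0, 0, 0, 0, 0, 0, 0, 0, -1, 0, 5, 0, -6, 0, 54, 0, -11, 0, 319]
    [0, 616, 0, 0, 0, 96, 0, 0, 0, 8]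
    [616, 0, 0, 0, 96, 0, 0, 0, 8, 0]
    rfl rfl (by decide +kernel)
  have : (8 : ℤ) ∣ 1276 := by
    rw [hS]
    exact dvd_sum fun u _ => splitFun_induction (P := fun a => (8 : ℤ) ∣ a)
      (dvd_zero _) (by decide) (by decide) _ u
  exact absurd this (by decide)

end ExtremalLengths

/-- For each listed pair `(2n, d)` there is a double circulant even
`[2n, n, d]` code which is not self-dual, while every self-dual code of length `2n`
has minimum weight strictly less than `d`. -/
theorem stmt_10 (m d : ℕ)
    (h : (2 * (m + 1), d) ∈ [(34, 8), (42, 10), (44, 10), (58, 12)]) :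
    (∃ C : Submodule (ZMod 2) (Fin (m + 1) ⊕ Fin (m + 1) → ZMod 2),
      IsDC C ∧ IsEvenCode C ∧ ¬ IsSelfDual C ∧
      Module.finrank (ZMod 2) C = m + 1 ∧ HasMinWt C d) ∧
    ∀ C' : Submodule (ZMod 2) (Fin (m + 1) ⊕ Fin (m + 1) → ZMod 2),
      IsSelfDual C' → ∀ d', HasMinWt C' d' → d' < d := by
  have hlt : ∀ {C : Submodule (ZMod 2) (Fin (m + 1) ⊕ Fin (m + 1) → ZMod 2)} {d' : ℕ},
      HasMinWt C d' → (¬ ∀ c ∈ C, c ≠ 0 → d ≤ wt c) → d' < d := by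
    intro C d' hmin hC
    by_contra! hle
    exact hC fun c hc hc0 => hle.trans (hmin.2 c hc hc0)
  simp only [List.mem_cons, Prod.mk.injEq, List.not_mem_nil, or_false] at h
  rcases h with ⟨hm, rfl⟩ | ⟨hm, rfl⟩ | ⟨hm, rfl⟩ | ⟨hm, rfl⟩
  · obtain rfl : m = 16 := by omega
    exact ⟨exists_doubleCirculant_34,
      fun C hC d' hmin => hlt hmin fun hd => not_isSelfDual_34 hd hC⟩
  · obtain rfl : m = 20 := by omega
    exact ⟨exists_doubleCirculant_42,
      fun C hC d' hmin => hlt hmin fun hd => not_isSelfDual_42 hd hC⟩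
  · obtain rfl : m = 21 := by omega
    exact ⟨exists_doubleCirculant_44,
      fun C hC d' hmin => hlt hmin fun hd => not_isSelfDual_44 hd hC⟩
  · obtain rfl : m = 28 := by omega
    exact ⟨exists_doubleCirculant_58,
      fun C hC d' hmin => hlt hmin fun hd => not_isSelfDual_58 hd hC⟩
end

section
/- Every double circulant even binary code of length 48 (pure or bordered) that is not self-dual has minimum weight at most 10; that is, there is no double circulant even [48,24,d] code with d ≥ 12 which is not self-dual. -/
namespace DoubleCirculant

/-! ### Bit-sliced circuits

A natural number is read as the truth table of a Boolean function: its value at the assignment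
`t` is bit `t`. A list of such numbers is read either as a family of Boolean functions or as
the binary digits, least significant first, of a function with values in `ℕ`. The functions
evaluated by the kernel are written with recursors, which reduce faster than compiled
structural recursion. -/

/-- Cyclic rotation of a list. -/
def rotl (l : List ℕ) (i : ℕ) : List ℕ := l.drop i ++ l.take i

/-- Pointwise exclusive or of two lists. -/
noncomputable def xorl (l : List ℕ) : List ℕ → List ℕ :=
  List.rec (fun _ => [])
    (fun x _ ih u => List.rec [] (fun y ys _ => Nat.xor x y :: ih ys) u) l

/-- Exclusive or of the rotations of `l` by the elements of `a`. -/
noncomputable def xorRows (l a : List ℕ) : List ℕ :=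
  List.rec [] (fun i a ih => List.rec (rotl l i) (fun _ _ _ => xorl (rotl l i) ih) a) a

/-- Ripple-carry addition of one bit. -/
noncomputable def inc (l : List ℕ) : ℕ → List ℕ :=
  List.rec (fun c => [c]) (fun x _ ih c => Nat.xor x c :: ih (Nat.land x c)) l

/-- Ripple-carry addition with a carry bit. -/
noncomputable def addc (l : List ℕ) : List ℕ → ℕ → List ℕ :=
  List.rec inc (fun x xs ih u c => List.rec (inc (x :: xs) c)
    (fun y ys _ => Nat.xor (Nat.xor x y) c ::
      ih ys (Nat.lor (Nat.land x y) (Nat.land (Nat.xor x y) c))) u) l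

/-- Adds up the first `2 ^ (d + 1) - 1` bits of a list; the continuation receives the sum and
the remaining bits. -/
noncomputable def count (d : ℕ) : List ℕ → (List ℕ → List ℕ → ℕ) → ℕ :=
  Nat.rec (fun l k => List.rec (k [] []) (fun x l _ => k [x] l) l)
    (fun _ ih l k => ih l fun s l => ih l fun u l =>
      List.rec (k (addc s u 0) []) (fun c l _ => k (addc s u c) l) l) d

/-- The assignments at which the number with digits `l` is at least `T`. -/
noncomputable def ge (F : ℕ) (l : List ℕ) : ℕ → ℕ :=
  List.rec (fun T => bif Nat.beq T 0 then F else 0)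
    (fun b _ ih T => bif Nat.beq (T % 2) 0 then ih (T / 2)
      else Nat.lor (Nat.land b (ih (T / 2))) (ih (T / 2 + 1))) l

/-- The assignments at which the combination of rotations of `l` given by `a` has weight
between `lo a.length` and `hi a.length`. -/
noncomputable def inWindow (lo hi : ℕ → ℕ) (F : ℕ) (l a : List ℕ) : ℕ :=
  count 4 (xorRows l a) fun s _ =>
    Nat.land (ge F s (lo a.length)) (Nat.xor F (ge F s (hi a.length + 1)))

/-- Checks that every assignment in `s` is rejected by some test. -/
noncomputable def covers (test : List ℕ → ℕ) (l : List (List ℕ)) : ℕ → Bool :=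
  List.rec (fun s => Nat.beq s 0)
    (fun a _ ih s => bif Nat.beq s 0 then true else ih (Nat.land s (test a))) l

/-- Truth tables of `k` independent variables. -/
def tables : ℕ → List ℕ
  | 0 => []
  | k + 1 => Nat.shiftLeft (2 ^ 2 ^ k - 1) (2 ^ k) ::
      (tables k).map fun x => Nat.lor x (Nat.shiftLeft x (2 ^ k))

/-- Periodic autocorrelation at shift `i`. -/
def autocorr (l : List ℕ) (i : ℕ) : ℕ :=
  (List.zipWith Nat.land l (rotl l i)).foldr Nat.xor 0

/-- The assignments at which some autocorrelation at a shift in `1, …, k` differs from `c`. -/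
def offPeak (c : ℕ) (l : List ℕ) (k : ℕ) : ℕ :=
  ((List.range k).map fun i => Nat.xor c (autocorr l (i + 1))).foldr Nat.lor 0

/-- Exhaustive search over the sequences of parity `p` of the form `x, cs, y₁, …, yₘ`: each of
them has all nontrivial autocorrelations equal to `1 + p`, or violates a weight bound. -/
noncomputable def search (lo hi : ℕ → ℕ) (p : Bool) (words : List (List ℕ)) (m : ℕ)
    (cs : List Bool) : Bool :=
  let F := 2 ^ 2 ^ m - 1
  let u := (cs.map fun b => bif b then F else 0) ++ tables m
  let l := u.foldr Nat.xor (bif p then F else 0) :: u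
  covers (inWindow lo hi F l) words (offPeak (bif p then 0 else F) l u.length)

/-! ### Semantics of the circuits -/

/-- The value of a truth table at an assignment, as an element of `ZMod 2`. -/
def ev (t x : ℕ) : ZMod 2 := ((x.testBit t).toNat : ZMod 2)

theorem ev_ne_zero {t x : ℕ} : ev t x ≠ 0 ↔ x.testBit t = true := by
  unfold ev; cases x.testBit t <;> simp

theorem ev_xor (t x y : ℕ) : ev t (Nat.xor x y) = ev t x + ev t y := by
  have : (Nat.xor x y).testBit t = (x.testBit t ^^ y.testBit t) := Nat.testBit_xor x y t
  unfold ev; rw [this]; cases x.testBit t <;> cases y.testBit t <;> decide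

theorem ev_land (t x y : ℕ) : ev t (Nat.land x y) = ev t x * ev t y := by
  have : (Nat.land x y).testBit t = (x.testBit t && y.testBit t) := Nat.testBit_and x y t
  unfold ev; rw [this]; cases x.testBit t <;> cases y.testBit t <;> decide

theorem ev_zero (t : ℕ) : ev t 0 = 0 := by simp [ev]

theorem ev_foldr_xor (t c : ℕ) (l : List ℕ) :
    ev t (l.foldr Nat.xor c) = (l.map (ev t)).sum + ev t c := by
  induction l with
  | nil => simp
  | cons x l ih => rw [List.foldr_cons, ev_xor, ih, List.map_cons, List.sum_cons, add_assoc]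

/-- The number with binary digits `l` at the assignment `t`. -/
def digits (t : ℕ) : List ℕ → ℕ
  | [] => 0
  | x :: l => (x.testBit t).toNat + 2 * digits t l

theorem digits_inc (t : ℕ) (l : List ℕ) (c : ℕ) :
    digits t (inc l c) = digits t l + (c.testBit t).toNat := by
  induction l generalizing c with
  | nil => simp [inc, digits]
  | cons x l ih =>
    change ((x ^^^ c).testBit t).toNat + 2 * digits t (inc l (x &&& c)) = _
    rw [ih, Nat.testBit_xor, Nat.testBit_and, digits]
    cases x.testBit t <;> cases c.testBit t <;> simp <;> omega

theorem digits_addc (t : ℕ) (l l' : List ℕ) (c : ℕ) :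
    digits t (addc l l' c) = digits t l + digits t l' + (c.testBit t).toNat := by
  induction l generalizing l' c with
  | nil =>
    change digits t (inc l' c) = _
    rw [digits_inc, digits, zero_add]
  | cons x l ih =>
    cases l' with
    | nil =>
      change digits t (inc (x :: l) c) = _
      rw [digits_inc]; rfl
    | cons y l' =>
      change ((x ^^^ y ^^^ c).testBit t).toNat +
        2 * digits t (addc l l' ((x &&& y) ||| ((x ^^^ y) &&& c))) = _
      rw [ih]
      simp only [Nat.testBit_xor, Nat.testBit_and, Nat.testBit_or, digits]
      cases x.testBit t <;> cases y.testBit t <;> cases c.testBit t <;> simp <;> omega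

theorem exists_count_eq (t d : ℕ) (l : List ℕ) (k : List ℕ → List ℕ → ℕ) :
    ∃ s l', count d l k = k s l' ∧ l'.length = l.length - (2 ^ (d + 1) - 1) ∧
      digits t s + (l'.map fun x => (x.testBit t).toNat).sum =
        (l.map fun x => (x.testBit t).toNat).sum := by
  induction d generalizing l k with
  | zero =>
    cases l with
    | nil => exact ⟨[], [], rfl, by simp, by simp [digits]⟩
    | cons x l => exact ⟨[x], l, rfl, by simp, by simp [digits]⟩
  | succ d ih =>
    change ∃ s l', (count d l fun s l => count d l fun s' l =>
      List.rec (k (addc s s' 0) []) (fun c l _ => k (addc s s' c) l) l) = k s l' ∧ _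
    obtain ⟨s₁, l₁, h₁, hl₁, hs₁⟩ := ih l fun s l => count d l fun s' l =>
      List.rec (k (addc s s' 0) []) (fun c l _ => k (addc s s' c) l) l
    obtain ⟨s₂, l₂, h₂, hl₂, hs₂⟩ := ih l₁ fun s' l =>
      List.rec (k (addc s₁ s' 0) []) (fun c l _ => k (addc s₁ s' c) l) l
    rw [h₁, h₂]
    have hpow : 2 ^ (d + 1 + 1) = 2 * 2 ^ (d + 1) := by ring
    have hpos : 0 < 2 ^ (d + 1) := by positivity
    cases l₂ with
    | nil =>
      refine ⟨_, _, rfl, ?_, ?_⟩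
      · simp only [List.length_nil] at hl₂ ⊢; omega
      · simp [digits_addc] at hs₂ ⊢; omega
    | cons c l₂ =>
      refine ⟨_, _, rfl, ?_, ?_⟩
      · simp only [List.length_cons] at hl₂; omega
      · simp [digits_addc] at hs₂ ⊢; omega

theorem testBit_ge {t F : ℕ} (hF : F.testBit t = true) (l : List ℕ) (T : ℕ) :
    (ge F l T).testBit t = decide (T ≤ digits t l) := by
  induction l generalizing T with
  | nil =>
    change (bif Nat.beq T 0 then F else 0).testBit t = _
    cases T with
    | zero => simpa [digits] using hF
    | succ T => simp [digits, Nat.beq]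
  | cons b l ih =>
    change (bif Nat.beq (T % 2) 0 then ge F l (T / 2)
      else (b &&& ge F l (T / 2)) ||| ge F l (T / 2 + 1)).testBit t = _
    rw [digits]
    rcases Nat.mod_two_eq_zero_or_one T with h | h
    · rw [h]
      change (ge F l (T / 2)).testBit t = _
      rw [ih, decide_eq_decide]
      cases b.testBit t <;> simp <;> omega
    · rw [h]
      change ((b &&& ge F l (T / 2)) ||| ge F l (T / 2 + 1)).testBit t = _
      rw [Nat.testBit_or, Nat.testBit_and, ih, ih]
      cases b.testBit t <;> simp <;> grind

theorem exists_of_covers {test : List ℕ → ℕ} {l : List (List ℕ)} {s t : ℕ}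
    (h : covers test l s = true) (hs : s.testBit t = true) :
    ∃ a ∈ l, (test a).testBit t = false := by
  induction l generalizing s with
  | nil =>
    have h : Nat.beq s 0 = true := h
    rw [Nat.eq_of_beq_eq_true h] at hs
    simp at hs
  | cons a l ih =>
    change (bif Nat.beq s 0 then true else covers test l (s &&& test a)) = true at h
    cases hb : Nat.beq s 0 with
    | true =>
      rw [Nat.eq_of_beq_eq_true hb] at hs
      simp at hs
    | false =>
      rw [hb, cond_false] at h
      cases ha : (test a).testBit t with
      | false => exact ⟨a, by simp, ha⟩
      | true =>
        obtain ⟨b, hb, hb'⟩ := ih h (by rw [Nat.testBit_and, hs, ha]; rfl)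
        exact ⟨b, List.mem_cons_of_mem _ hb, hb'⟩

theorem length_tables (k : ℕ) : (tables k).length = k := by
  induction k with
  | zero => rfl
  | succ k ih => simp [tables, ih]

theorem tables_lt (k : ℕ) : ∀ x ∈ tables k, x < 2 ^ 2 ^ k := by
  induction k with
  | zero => simp [tables]
  | succ k ih =>
    have hpow : (2 : ℕ) ^ 2 ^ (k + 1) = 2 ^ 2 ^ k * 2 ^ 2 ^ k := by rw [pow_succ, pow_mul, sq]
    have hle : (2 : ℕ) ^ 2 ^ k ≤ 2 ^ 2 ^ (k + 1) := by
      rw [hpow]; exact Nat.le_mul_of_pos_left _ (by positivity)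
    have hshift : ∀ x < 2 ^ 2 ^ k, Nat.shiftLeft x (2 ^ k) < 2 ^ 2 ^ (k + 1) := by
      intro x hx
      change x <<< (2 ^ k) < _
      rw [Nat.shiftLeft_eq, hpow]
      exact Nat.mul_lt_mul_of_pos_right hx (by positivity)
    intro x hx
    rw [tables, List.mem_cons, List.mem_map] at hx
    rcases hx with rfl | ⟨y, hy, rfl⟩
    · exact hshift _ (by have : 0 < 2 ^ 2 ^ k := by positivity
                         omega)
    · exact Nat.or_lt_two_pow ((ih y hy).trans_le hle) (hshift y (ih y hy))

theorem exists_testBit_tables (k : ℕ) (b : List Bool) (hb : b.length = k) :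
    ∃ t < 2 ^ k, (tables k).map (fun x => x.testBit t) = b := by
  induction k generalizing b with
  | zero => exact ⟨0, by simp, by simp [tables, List.length_eq_zero_iff.1 hb]⟩
  | succ k ih =>
    obtain ⟨c, b, rfl⟩ := List.exists_cons_of_length_eq_add_one hb
    obtain ⟨t, ht, rfl⟩ := ih b (by simpa using hb)
    have hor (x u : ℕ) : (Nat.lor x (Nat.shiftLeft x (2 ^ k))).testBit u =
        (x.testBit u || (decide (2 ^ k ≤ u) && x.testBit (u - 2 ^ k))) := by
      change (x ||| x <<< (2 ^ k)).testBit u = _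
      rw [Nat.testBit_or, Nat.testBit_shiftLeft]
    have hsh (u : ℕ) : (Nat.shiftLeft (2 ^ 2 ^ k - 1) (2 ^ k)).testBit u =
        (decide (2 ^ k ≤ u) && decide (u - 2 ^ k < 2 ^ k)) := by
      change ((2 ^ 2 ^ k - 1) <<< (2 ^ k)).testBit u = _
      rw [Nat.testBit_shiftLeft, Nat.testBit_two_pow_sub_one]
    cases c with
    | false =>
      refine ⟨t, by rw [pow_succ]; omega, ?_⟩
      rw [tables, List.map_cons, hsh, List.map_map]
      congr 1
      · simp [ht]
      · refine List.map_congr_left fun x _ => ?_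
        simp only [Function.comp, hor]
        simp [Nat.not_le.2 ht]
    | true =>
      refine ⟨t + 2 ^ k, by rw [pow_succ]; omega, ?_⟩
      rw [tables, List.map_cons, hsh, List.map_map]
      congr 1
      · simp [ht]
      · refine List.map_congr_left fun x hx => ?_
        simp only [Function.comp, hor]
        have : x.testBit (t + 2 ^ k) = false :=
          Nat.testBit_eq_false_of_lt ((tables_lt k x hx).trans_le
            (Nat.pow_le_pow_right (by norm_num) (by omega)))
        simp [this]

/-! ### Sequences represented by circuits -/

section Sequences

variable {n : ℕ}

/-- At the assignment `t`, the truth tables in `l` take the values of the sequence `ρ`. -/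
def Represents (t : ℕ) (l : List ℕ) (ρ : Fin n → ZMod 2) : Prop :=
  l.map (ev t) = List.ofFn ρ

theorem Represents.xorl {t : ℕ} {l l' : List ℕ} {ρ ρ' : Fin n → ZMod 2}
    (h : Represents t l ρ) (h' : Represents t l' ρ') :
    Represents t (xorl l l') fun j => ρ j + ρ' j := by
  have hmap (l l' : List ℕ) : (DoubleCirculant.xorl l l').map (ev t) =
      List.zipWith (· + ·) (l.map (ev t)) (l'.map (ev t)) := by
    induction l generalizing l' with
    | nil => rfl
    | cons x l ih =>
      cases l' with
      | nil => rfl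
      | cons y l' =>
        change ev t (Nat.xor x y) :: (DoubleCirculant.xorl l l').map (ev t) = _
        rw [ih, ev_xor]; rfl
  unfold Represents at *
  rw [hmap, h, h']
  refine List.ext_getElem (by simp) fun j h₁ h₂ => by simp

theorem wt_eq_sum {ι : Type*} [Fintype ι] (x : ι → ZMod 2) :
    wt x = ∑ i, if x i ≠ 0 then 1 else 0 := by
  rw [wt, Finset.card_filter]

theorem Represents.sum_testBit {t : ℕ} {l : List ℕ} {ρ : Fin n → ZMod 2}
    (h : Represents t l ρ) : (l.map fun x => (x.testBit t).toNat).sum = wt ρ := by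
  have hl : (l.map fun x => (x.testBit t).toNat) =
      (l.map (ev t)).map fun x => if x ≠ 0 then 1 else 0 := by
    rw [List.map_map]
    refine List.map_congr_left fun x _ => ?_
    simp only [Function.comp, ev_ne_zero]
    cases x.testBit t <;> rfl
  rw [hl, show l.map (ev t) = _ from h, List.map_ofFn, List.sum_ofFn, wt_eq_sum]
  rfl

variable [NeZero n]

/-- The combination of shifts of `ρ` given by a list of shifts. -/
def shiftSum (ρ : Fin n → ZMod 2) (a : List ℕ) (j : Fin n) : ZMod 2 :=
  (a.map fun i => ρ (j + Fin.ofNat n i)).sum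

theorem Represents.rotl {t : ℕ} {l : List ℕ} {ρ : Fin n → ZMod 2} (h : Represents t l ρ)
    {i : ℕ} (hi : i < n) : Represents t (rotl l i) fun j => ρ (j + Fin.ofNat n i) := by
  unfold Represents at *
  rw [DoubleCirculant.rotl, List.map_append, List.map_drop, List.map_take, h,
    ← List.rotate_eq_drop_append_take (by simpa using hi.le)]
  refine List.ext_getElem (by simp) fun j h₁ h₂ => ?_
  simp only [List.length_ofFn] at h₂
  rw [List.getElem_rotate, List.getElem_ofFn, List.getElem_ofFn]
  congr 1
  ext
  simp [Fin.val_add, Nat.mod_eq_of_lt hi]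

theorem Represents.xorRows {t : ℕ} {l : List ℕ} {ρ : Fin n → ZMod 2} (h : Represents t l ρ)
    {a : List ℕ} (ha : a ≠ []) (hlt : ∀ i ∈ a, i < n) :
    Represents t (xorRows l a) (shiftSum ρ a) := by
  induction a with
  | nil => exact absurd rfl ha
  | cons i a ih =>
    cases a with
    | nil =>
      have hsum : shiftSum ρ [i] = fun j => ρ (j + Fin.ofNat n i) := by
        funext j; simp [shiftSum]
      rw [hsum]
      exact h.rotl (hlt i (by simp))
    | cons k a =>
      have hsum : shiftSum ρ (i :: k :: a) =
          fun j => ρ (j + Fin.ofNat n i) + shiftSum ρ (k :: a) j := by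
        funext j; simp [shiftSum]
      rw [hsum]
      exact (h.rotl (hlt i (by simp))).xorl
        (ih (by simp) fun i hi => hlt i (List.mem_cons_of_mem _ hi))

theorem Represents.testBit_inWindow {t F : ℕ} {l : List ℕ} {ρ : Fin n → ZMod 2}
    (h : Represents t l ρ) (hF : F.testBit t = true) (hn : n ≤ 31) (lo hi : ℕ → ℕ)
    {a : List ℕ} (ha : a ≠ []) (hlt : ∀ i ∈ a, i < n) (hlo : lo a.length ≤ wt (shiftSum ρ a))
    (hhi : wt (shiftSum ρ a) ≤ hi a.length) : (inWindow lo hi F l a).testBit t = true := by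
  have hx := h.xorRows ha hlt
  obtain ⟨s, l', hc, hl', hs⟩ := exists_count_eq t 4 (DoubleCirculant.xorRows l a) fun s _ =>
    Nat.land (ge F s (lo a.length)) (Nat.xor F (ge F s (hi a.length + 1)))
  have hlen : (DoubleCirculant.xorRows l a).length = n := by
    simpa using congrArg List.length hx
  obtain rfl : l' = [] := List.length_eq_zero_iff.1 (by omega)
  rw [hx.sum_testBit, List.map_nil, List.sum_nil, add_zero] at hs
  rw [inWindow, hc]
  change (ge F s (lo a.length) &&& (F ^^^ ge F s (hi a.length + 1))).testBit t = true
  rw [Nat.testBit_and, Nat.testBit_xor, testBit_ge hF, testBit_ge hF, hF, hs]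
  simp only [hlo, decide_true, Bool.true_and, Bool.true_xor, Bool.not_eq_true',
    decide_eq_false_iff_not]
  omega

theorem Represents.ev_autocorr {t : ℕ} {l : List ℕ} {ρ : Fin n → ZMod 2}
    (h : Represents t l ρ) {i : ℕ} (hi : i < n) :
    ev t (autocorr l i) = ∑ j, ρ j * ρ (j + Fin.ofNat n i) := by
  have hmap (l l' : List ℕ) : (List.zipWith Nat.land l l').map (ev t) =
      List.zipWith (· * ·) (l.map (ev t)) (l'.map (ev t)) := by
    rw [List.map_zipWith, List.zipWith_map]
    simp only [ev_land]
  rw [autocorr, ev_foldr_xor, hmap, show l.map (ev t) = _ from h,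
    show (DoubleCirculant.rotl l i).map (ev t) = _ from h.rotl hi, ev_zero, add_zero,
    ← List.sum_ofFn]
  congr 1
  refine List.ext_getElem (by simp) fun j h₁ h₂ => by simp

theorem testBit_foldr_lor (t : ℕ) (l : List ℕ) {x : ℕ} (hx : x ∈ l) (h : x.testBit t = true) :
    (l.foldr Nat.lor 0).testBit t = true := by
  induction l with
  | nil => simp at hx
  | cons y l ih =>
    change (y ||| l.foldr Nat.lor 0).testBit t = true
    rw [Nat.testBit_or]
    rcases List.mem_cons.1 hx with rfl | hx
    · rw [h]; rfl
    · rw [ih hx, Bool.or_true]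

/-- Soundness of the exhaustive search. -/
theorem autocorr_eq_of_search {lo hi : ℕ → ℕ} {p : Bool} {words : List (List ℕ)} {m : ℕ}
    {cs bs : List Bool} {ρ : Fin n → ZMod 2} (h : search lo hi p words m cs = true)
    (hbs : bs.length = m) (hn : n ≤ 31)
    (hρ : List.ofFn ρ = ρ 0 :: (cs ++ bs).map fun b => (b.toNat : ZMod 2))
    (hsum : ∑ j, ρ j = (p.toNat : ZMod 2))
    (hwords : ∀ a ∈ words, a ≠ [] ∧ ∀ i ∈ a, i < n)
    (hwt : ∀ a ∈ words, lo a.length ≤ wt (shiftSum ρ a) ∧ wt (shiftSum ρ a) ≤ hi a.length)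
    {i : Fin n} (hi0 : i ≠ 0) : ∑ j, ρ j * ρ (j + i) = 1 + (p.toNat : ZMod 2) := by
  obtain ⟨t, ht, htab⟩ := exists_testBit_tables m bs hbs
  set F := 2 ^ 2 ^ m - 1 with hFdef
  have hF : F.testBit t = true := by rw [hFdef, Nat.testBit_two_pow_sub_one]; simpa using ht
  have hevF (b : Bool) : ev t (bif b then F else 0) = (b.toNat : ZMod 2) := by
    cases b <;> simp [ev, hF]
  set l' := (cs.map fun b => bif b then F else 0) ++ tables m with hl'
  set l := l'.foldr Nat.xor (bif p then F else 0) :: l' with hl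
  have hmap' : l'.map (ev t) = (cs ++ bs).map fun b => (b.toNat : ZMod 2) := by
    rw [hl', List.map_append, List.map_append, List.map_map]
    congr 1
    · exact List.map_congr_left fun b _ => hevF b
    · rw [← htab, List.map_map]; rfl
  have hhead : ev t (l'.foldr Nat.xor (bif p then F else 0)) = ρ 0 := by
    rw [ev_foldr_xor, hmap', hevF, ← hsum, ← List.sum_ofFn, hρ, List.sum_cons, add_left_comm,
      CharTwo.add_self_eq_zero, add_zero]
  have hrep : Represents t l ρ := by
    rw [Represents, hρ, hl, List.map_cons, hmap', hhead]
  have hlen : l'.length + 1 = n := by simpa [hl] using congrArg List.length hrep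
  by_contra hne
  have hoff : (offPeak (bif p then 0 else F) l l'.length).testBit t = true := by
    refine testBit_foldr_lor t _ (x := Nat.xor (bif p then 0 else F) (autocorr l (i - 1 + 1)))
      (List.mem_map.2 ⟨i - 1, ?_, rfl⟩) (ev_ne_zero.1 ?_)
    · have := i.isLt
      rw [List.mem_range]
      have : (i : ℕ) ≠ 0 := fun h => hi0 (Fin.ext h)
      omega
    · have hpos : (i : ℕ) - 1 + 1 = i := by
        have : (i : ℕ) ≠ 0 := fun h => hi0 (Fin.ext h)
        omega
      rw [ev_xor, hpos, hrep.ev_autocorr i.isLt, Fin.ofNat_val_eq_self]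
      intro h0
      apply hne
      rw [← CharTwo.add_eq_zero, add_comm, ← h0]
      congr 1
      cases p <;> simp [ev, hF]
      decide
  obtain ⟨a, ha, hfalse⟩ := exists_of_covers h hoff
  rw [hrep.testBit_inWindow hF hn lo hi (hwords a ha).1 (hwords a ha).2 (hwt a ha).1
    (hwt a ha).2] at hfalse
  exact absurd hfalse (by decide)

theorem wt_shift (ρ : Fin n → ZMod 2) (k : Fin n) : wt (fun j => ρ (j + k)) = wt ρ := by
  rw [wt_eq_sum, wt_eq_sum]
  exact Equiv.sum_comp (Equiv.addRight k) fun j => if ρ j ≠ 0 then 1 else 0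

theorem wt_shiftSum_shift (ρ : Fin n → ZMod 2) (k : Fin n) (a : List ℕ) :
    wt (shiftSum (fun j => ρ (j + k)) a) = wt (shiftSum ρ a) := by
  rw [← wt_shift (shiftSum ρ a) k]
  unfold shiftSum
  simp only [add_right_comm]

theorem autocorr_shift (ρ : Fin n → ZMod 2) (k i : Fin n) :
    ∑ j, ρ (j + k) * ρ (j + i + k) = ∑ j, ρ j * ρ (j + i) := by
  rw [← Equiv.sum_comp (Equiv.addRight k) fun j => ρ j * ρ (j + i)]
  simp [add_right_comm]

/-- A nonconstant cyclic binary sequence contains the pattern `1, 0`. -/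
theorem exists_descent {ρ : Fin n → ZMod 2} (h0 : ∃ j, ρ j ≠ 0) (h1 : ∃ j, ρ j ≠ 1) :
    ∃ k, ρ k = 1 ∧ ρ (k + 1) = 0 := by
  have h01 : ∀ x : ZMod 2, x ≠ 0 → x = 1 := by decide
  by_contra! h
  obtain ⟨k, hk⟩ := h0
  obtain ⟨j, hj⟩ := h1
  have hall (i : ℕ) : ρ (k + Fin.ofNat n i) = 1 := by
    induction i with
    | zero => simpa using h01 _ hk
    | succ i ih =>
      have : Fin.ofNat n (i + 1) = Fin.ofNat n i + 1 := by
        ext; simp [Fin.val_add]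
      rw [this, ← add_assoc]
      exact h01 _ (h _ ih)
  apply hj
  have := hall (j - k : Fin n)
  rwa [Fin.ofNat_val_eq_self, add_sub_cancel] at this

theorem autocorr_eq_of_forall_search {lo hi : ℕ → ℕ} {p : Bool} {words : List (List ℕ)}
    {r m : ℕ} {ρ : Fin n → ZMod 2} (hnr : n = r + m + 3) (hn : n ≤ 31)
    (h : ∀ bs : List Bool, bs.length = r →
      search lo hi p words m (true :: false :: bs) = true)
    (h0 : ∃ j, ρ j ≠ 0) (h1 : ∃ j, ρ j ≠ 1) (hsum : ∑ j, ρ j = (p.toNat : ZMod 2))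
    (hwords : ∀ a ∈ words, a ≠ [] ∧ ∀ i ∈ a, i < n)
    (hwt : ∀ a ∈ words, lo a.length ≤ wt (shiftSum ρ a) ∧ wt (shiftSum ρ a) ≤ hi a.length)
    {i : Fin n} (hi0 : i ≠ 0) : ∑ j, ρ j * ρ (j + i) = 1 + (p.toNat : ZMod 2) := by
  obtain ⟨k, hk1, hk0⟩ := exists_descent h0 h1
  rw [← autocorr_shift ρ (k - 1) i]
  let σ : Fin n → ZMod 2 := fun j => ρ (j + (k - 1))
  have hσsum : ∑ j, σ j = (p.toNat : ZMod 2) := by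
    rw [← hsum]; exact Equiv.sum_comp (Equiv.addRight (k - 1)) ρ
  have hσ1 : σ 1 = 1 := by simpa [σ] using hk1
  have hσ2 : σ (1 + 1) = 0 := by
    have : (1 + 1 + (k - 1) : Fin n) = k + 1 := by abel
    simpa [σ, this] using hk0
  have hσwt : ∀ a ∈ words, lo a.length ≤ wt (shiftSum σ a) ∧ wt (shiftSum σ a) ≤ hi a.length := by
    intro a ha
    rw [wt_shiftSum_shift]
    exact hwt a ha
  have hbit (x : ZMod 2) : ((decide (x ≠ 0)).toNat : ZMod 2) = x := by revert x; decide
  change ∑ j, σ j * σ (j + i) = _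
  clear_value σ
  subst hnr
  let bs : List Bool := List.ofFn fun j : Fin (r + m) => decide (σ j.succ.succ.succ ≠ 0)
  have hbs : bs.length = r + m := List.length_ofFn
  refine autocorr_eq_of_search (h (bs.take r) (by simp [hbs])) (bs := bs.drop r)
    (by simp [hbs]) hn ?_ hσsum hwords hσwt hi0
  rw [List.cons_append, List.cons_append, List.take_append_drop, List.map_cons, List.map_cons,
    List.map_ofFn, List.ofFn_succ, List.ofFn_succ, List.ofFn_succ]
  simp only [Function.comp_def, hbit]
  congr 2
  congr 1

/-! ### Codewords of double circulant codes -/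

theorem exists_finset_shiftSum {a : List ℕ} (hnd : a.Nodup) (hlt : ∀ i ∈ a, i < n) :
    ∃ S : Finset (Fin n), S.card = a.length ∧
      ∀ R : Matrix (Fin n) (Fin n) (ZMod 2), IsCirculant R →
        ∀ j, ∑ i ∈ S, R i j = shiftSum (R 0) a j := by
  have hnd' : (a.map fun i => -Fin.ofNat n i).Nodup := by
    refine hnd.map_on fun x hx y hy hxy => ?_
    have := congrArg Fin.val (neg_injective hxy)
    simpa [Nat.mod_eq_of_lt (hlt x hx), Nat.mod_eq_of_lt (hlt y hy)] using this
  refine ⟨(a.map fun i => -Fin.ofNat n i).toFinset, ?_, fun R hR j => ?_⟩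
  · rw [List.toFinset_card_of_nodup hnd', List.length_map]
  · rw [List.sum_toFinset _ hnd', List.map_map, shiftSum]
    congr 1
    refine List.map_congr_left fun i _ => ?_
    simpa using (hR (-Fin.ofNat n i) j (Fin.ofNat n i)).symm

end Sequences

theorem natCast_wt {ι : Type*} [Fintype ι] (x : ι → ZMod 2) : (wt x : ZMod 2) = ∑ i, x i := by
  rw [wt_eq_sum, Nat.cast_sum]
  refine Finset.sum_congr rfl fun i _ => ?_
  generalize x i = y
  revert y; decide

theorem sum_eq_zero_of_isEvenCode {ι : Type*} [Fintype ι]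
    {C : Submodule (ZMod 2) (ι → ZMod 2)} (hC : IsEvenCode C) {c : ι → ZMod 2} (hc : c ∈ C) :
    ∑ i, c i = 0 := by
  rw [← natCast_wt, ZMod.natCast_eq_zero_iff]
  exact hC c hc

theorem genMat_mem {n : ℕ} (M : Matrix (Fin n) (Fin n) (ZMod 2)) (i : Fin n) :
    genMat M i ∈ rowSpan (genMat M) :=
  Submodule.subset_span ⟨i, rfl⟩

theorem sum_genMat {n : ℕ} (M : Matrix (Fin n) (Fin n) (ZMod 2)) (i : Fin n) :
    ∑ j, genMat M i j = 1 + ∑ j, M i j := by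
  simp [genMat, Fintype.sum_sum_type]

theorem exists_mem_wt_eq {n : ℕ} (M : Matrix (Fin n) (Fin n) (ZMod 2)) {S : Finset (Fin n)}
    (hS : S.Nonempty) : ∃ c ∈ rowSpan (genMat M), c ≠ 0 ∧
      wt c = S.card + wt fun j => ∑ i ∈ S, M i j := by
  have hwt : wt (∑ i ∈ S, genMat M i) = S.card + wt fun j => ∑ i ∈ S, M i j := by
    have hl (j : Fin n) : (∑ i ∈ S, genMat M i) (Sum.inl j) = if j ∈ S then 1 else 0 := by
      refine (Finset.sum_apply _ _ _).trans ?_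
      simp [genMat]
    have hr (j : Fin n) : (∑ i ∈ S, genMat M i) (Sum.inr j) = ∑ i ∈ S, M i j := by
      refine (Finset.sum_apply _ _ _).trans ?_
      simp [genMat]
    rw [wt_eq_sum, wt_eq_sum, Fintype.sum_sum_type]
    simp [hl, hr]
  refine ⟨∑ i ∈ S, genMat M i, Submodule.sum_mem _ fun i _ => genMat_mem M i, fun h0 => ?_, hwt⟩
  rw [h0] at hwt
  have : wt (0 : Fin n ⊕ Fin n → ZMod 2) = 0 := by simp [wt]
  have := hS.card_pos
  omega

theorem isSelfDual_of_mul_transpose_eq_one {n : ℕ} {M : Matrix (Fin n) (Fin n) (ZMod 2)}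
    (h : M * M.transpose = 1) : IsSelfDual (rowSpan (genMat M)) := by
  have hdot (i : Fin n) (c : Fin n ⊕ Fin n → ZMod 2) :
      ∑ k, genMat M i k * c k = c (Sum.inl i) + ∑ j, M i j * c (Sum.inr j) := by
    simp [genMat, Fintype.sum_sum_type]
  have hrow : ∀ i, ∀ c ∈ rowSpan (genMat M), ∑ k, genMat M i k * c k = 0 := by
    intro i c hc
    induction hc using Submodule.span_induction with
    | mem c hc =>
      obtain ⟨k, rfl⟩ := hc
      have hik := congrFun (congrFun h i) k
      rw [Matrix.mul_apply, Matrix.one_apply] at hik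
      rw [hdot]
      simp only [genMat, Matrix.of_apply, Sum.elim_inl, Sum.elim_inr]
      simp only [Matrix.transpose_apply] at hik
      rw [hik]
      by_cases hki : k = i
      · subst hki; simp; decide
      · simp [hki, Ne.symm hki]
    | zero => simp
    | add x y _ _ hx hy => simp [mul_add, Finset.sum_add_distrib, hx, hy]
    | smul r x _ hx =>
      simp only [Pi.smul_apply, smul_eq_mul, mul_left_comm _ r, ← Finset.mul_sum, hx, mul_zero]
  have hle : rowSpan (genMat M) ≤ dualCode (rowSpan (genMat M)) := by
    refine Submodule.span_le.2 ?_
    rintro _ ⟨i, rfl⟩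
    exact hrow i
  refine le_antisymm hle fun x hx => ?_
  have hs : ∑ i, x (Sum.inl i) • genMat M i ∈ rowSpan (genMat M) :=
    Submodule.sum_mem _ fun i _ => Submodule.smul_mem _ _ (genMat_mem M i)
  have hy := Submodule.sub_mem _ hx (hle hs)
  set y := x - ∑ i, x (Sum.inl i) • genMat M i with hydef
  have hinl (i : Fin n) : y (Sum.inl i) = 0 := by
    simp [hydef, genMat, Finset.sum_apply]
  have hinr : M.mulVec (fun j => y (Sum.inr j)) = 0 := by
    funext i
    have hi : ∑ k, y k * genMat M i k = 0 := hy _ (genMat_mem M i)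
    simp only [mul_comm (y _)] at hi
    rw [hdot, hinl, zero_add] at hi
    exact hi
  have hzero : (fun j => y (Sum.inr j)) = 0 := by
    have := congrArg M.transpose.mulVec hinr
    rwa [Matrix.mulVec_mulVec, mul_eq_one_comm.1 h, Matrix.one_mulVec,
      Matrix.mulVec_zero] at this
  have hy0 : y = 0 := by
    funext k
    rcases k with k | k
    · exact hinl k
    · exact congrFun hzero k
  rw [sub_eq_zero.1 (hydef.symm.trans hy0)]
  exact hs

theorem sum_mul_circulant {n : ℕ} [NeZero n] {R : Matrix (Fin n) (Fin n) (ZMod 2)}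
    (hR : IsCirculant R) (i k : Fin n) :
    ∑ j, R i j * R k j = ∑ j, R 0 j * R 0 (j + (i - k)) := by
  rw [← Equiv.sum_comp (Equiv.addRight i) fun j => R i j * R k j]
  refine Finset.sum_congr rfl fun j _ => ?_
  have h₁ : R i (j + i) = R 0 j := by simpa using hR 0 j i
  have h₂ : R k (j + i) = R 0 (j + (i - k)) := by
    have h := hR 0 (j + (i - k)) k
    rwa [zero_add, show j + (i - k) + k = j + i by abel] at h
  simp [h₁, h₂]

theorem sum_mul_self {n : ℕ} (ρ : Fin n → ZMod 2) : ∑ j, ρ j * ρ j = ∑ j, ρ j := by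
  refine Finset.sum_congr rfl fun j _ => ?_
  generalize ρ j = y
  revert y; decide

theorem sum_circulant {n : ℕ} [NeZero n] {R : Matrix (Fin n) (Fin n) (ZMod 2)}
    (hR : IsCirculant R) (i : Fin n) : ∑ j, R i j = ∑ j, R 0 j := by
  rw [← sum_mul_self, sum_mul_circulant hR, sub_self]
  simp [sum_mul_self]

/-! ### Pure double circulant codes of length 48 -/

/-- Coefficient supports of codewords such that every relevant pure code has one of them as a
codeword of weight at most 10. -/
def pureWords : List (List ℕ) :=
  [[0], [0, 6, 12, 18], [0, 8], [0, 9], [0, 7], [0, 2], [0, 5], [0, 3], [0, 11], [0, 12], [0, 4],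
   [0, 10], [0, 6], [0, 1], [0, 6, 12], [0, 8, 16], [0, 2, 12], [0, 4, 10], [0, 6, 8],
   [0, 6, 10], [0, 2, 8], [0, 2, 6], [0, 4, 6], [0, 6, 14], [0, 8, 14], [0, 10, 12], [0, 3, 9],
   [0, 6, 9], [0, 3, 6], [0, 6, 15], [0, 1, 6], [0, 6, 13], [0, 5, 6], [0, 7, 13], [0, 1, 7],
   [0, 6, 11], [0, 5, 11], [0, 6, 7], [0, 3, 13], [0, 10, 13], [0, 2, 5], [0, 3, 5], [0, 1, 10],
   [0, 2, 9], [0, 9, 10], [0, 7, 9], [0, 1, 3], [0, 3, 10], [0, 10, 11], [0, 1, 11], [0, 5, 14],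
   [0, 7, 10], [0, 9, 14], [0, 9, 11], [0, 2, 3], [0, 2, 11], [0, 4, 12, 16], [0, 1, 12],
   [0, 11, 12], [0, 1, 4], [0, 4, 13], [0, 3, 4], [0, 9, 13], [0, 2, 10], [0, 8, 10], [0, 4, 14],
   [0, 3, 7], [0, 4, 7], [0, 4, 9], [0, 5, 9], [0, 1, 9], [0, 8, 15], [0, 8, 9], [0, 7, 15],
   [0, 1, 8], [0, 7, 8], [0, 3, 11], [0, 8, 11], [0, 5, 13], [0, 4, 5], [0, 7, 11], [0, 3, 8],
   [0, 5, 8], [0, 8, 13], [0, 5, 12], [0, 2, 7], [0, 5, 7], [0, 7, 12], [0, 1, 5], [0, 4, 11],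
   [0, 5, 10], [0, 7, 14], [0, 2, 6, 8], [0, 2, 4, 14], [0, 2, 10, 12], [0, 4, 6, 12],
   [0, 4, 12], [0, 8, 12], [0, 4, 8, 14], [0, 6, 10, 14], [0, 4, 10, 16], [0, 2, 4, 8],
   [0, 4, 6, 8], [0, 3, 12], [0, 9, 12], [0, 1, 11, 12], [0, 6, 12, 16], [0, 6, 8, 12],
   [0, 2, 4], [0, 2, 6, 15], [0, 4, 6, 15], [0, 1, 8, 13], [0, 2, 3, 6], [0, 3, 4, 6],
   [0, 2, 6, 10], [0, 4, 8, 10], [0, 4, 8, 13], [0, 5, 9, 13], [0, 2, 6, 11], [0, 1, 4, 7],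
   [0, 3, 11, 13], [0, 5, 9, 11], [0, 2, 10, 13], [0, 3, 6, 9], [0, 5, 12, 13], [0, 5, 7, 12],
   [0, 4, 7, 10], [0, 1, 7, 10], [0, 4, 6, 7], [0, 5, 11, 12], [0, 3, 9, 10], [0, 3, 5, 8],
   [0, 6, 7, 9], [0, 5, 9, 15], [0, 2, 3, 5], [0, 7, 14, 16], [0, 1, 3, 6], [0, 6, 10, 15],
   [0, 3, 7, 8], [0, 3, 6, 7], [0, 3, 5, 6], [0, 1, 3, 4], [0, 3, 4, 11], [0, 2, 3, 9],
   [0, 9, 10, 11], [0, 7, 8, 11], [0, 1, 12, 13], [0, 2, 9, 11], [0, 2, 5, 10], [0, 8, 9, 10],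
   [0, 3, 6, 10], [0, 1, 10, 15], [0, 1, 2, 10], [0, 9, 10, 12], [0, 8, 9, 13], [0, 2, 5, 11],
   [0, 6, 9, 11], [0, 5, 8, 9], [0, 2, 6, 13], [0, 7, 11, 13], [0, 4, 5, 13], [0, 5, 6, 9],
   [0, 2, 5, 7], [0, 1, 4, 9], [0, 2, 7, 9], [0, 8, 10, 11], [0, 1, 4, 8], [0, 4, 7, 8],
   [0, 2, 5, 9], [0, 3, 7, 9]]

theorem pureWords_spec : ∀ a ∈ pureWords, a ≠ [] ∧ a.Nodup ∧ ∀ i ∈ a, i < 24 := by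
  decide +kernel

theorem search_pureWords : ∀ bs : List Bool, bs.length = 3 →
    search (fun w => 12 - w) (fun _ => 24) true pureWords 18 (true :: false :: bs) = true
  | [b₁, b₂, b₃], _ => by
    cases b₁ <;> cases b₂ <;> cases b₃ <;> decide +kernel

theorem isSelfDual_pure {R : Matrix (Fin 24) (Fin 24) (ZMod 2)} (hR : IsCirculant R)
    (he : IsEvenCode (rowSpan (genMat R)))
    (hd : ∀ c ∈ rowSpan (genMat R), c ≠ 0 → 12 ≤ wt c) : IsSelfDual (rowSpan (genMat R)) := by
  have hsum : ∑ j, R 0 j = 1 := by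
    have h := sum_eq_zero_of_isEvenCode he (genMat_mem R 0)
    rw [sum_genMat] at h
    exact (CharTwo.add_eq_zero.1 h).symm
  have hwt : ∀ a ∈ pureWords, 12 - a.length ≤ wt (shiftSum (R 0) a) ∧
      wt (shiftSum (R 0) a) ≤ 24 := by
    intro a ha
    obtain ⟨hne, hnd, hlt⟩ := pureWords_spec a ha
    obtain ⟨S, hS, hSR⟩ := exists_finset_shiftSum hnd hlt
    have hpos : 0 < S.card := hS ▸ List.length_pos_iff.2 hne
    obtain ⟨c, hc, hc0, hcw⟩ := exists_mem_wt_eq R (Finset.card_pos.1 hpos)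
    have h12 := hd c hc hc0
    simp only [hSR R hR] at hcw
    change wt c = S.card + wt (shiftSum (R 0) a) at hcw
    refine ⟨by omega, ?_⟩
    exact (Finset.card_filter_le Finset.univ fun i => shiftSum (R 0) a i ≠ 0).trans (by simp)
  have h0 : ∃ j, R 0 j ≠ 0 := by
    by_contra! h
    simp [h] at hsum
  have h1 : ∃ j, R 0 j ≠ 1 := by
    by_contra! h
    simp only [h] at hsum
    revert hsum
    decide
  refine isSelfDual_of_mul_transpose_eq_one ?_
  ext i k
  rw [Matrix.mul_apply, Matrix.one_apply]
  simp only [Matrix.transpose_apply]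
  rw [sum_mul_circulant hR]
  by_cases hik : i = k
  · simp [hik, sum_mul_self, hsum]
  · rw [if_neg hik, autocorr_eq_of_forall_search (by norm_num) (by norm_num) search_pureWords
      h0 h1 (by simpa using hsum)
      (fun a ha => ⟨(pureWords_spec a ha).1, (pureWords_spec a ha).2.2⟩) hwt (sub_ne_zero.2 hik)]
    decide

/-! ### Bordered double circulant codes of length 48 -/

/-- Coefficient supports of codewords such that every relevant bordered code has one of them,
possibly after adding the border row, as a codeword of weight at most 10. -/
def borderedWords : List (List ℕ) :=
  [[0, 8], [0, 3], [0, 5], [0, 2], [0, 6], [0, 9], [0, 11], [0, 4], [0, 10], [0, 7], [0, 1], [0],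
   [0, 6, 14], [0, 8, 14], [0, 3, 11], [0, 8, 11], [0, 2, 10], [0, 8, 10], [0, 2, 11],
   [0, 9, 11], [0, 2, 8], [0, 6, 8], [0, 2, 5], [0, 3, 5], [0, 1, 9], [0, 8, 9], [0, 3, 8],
   [0, 5, 8], [0, 3, 12], [0, 9, 12], [0, 2, 12], [0, 10, 12], [0, 1, 3], [0, 2, 3], [0, 1, 10],
   [0, 9, 10], [0, 4, 13], [0, 9, 13], [0, 4, 12], [0, 8, 12], [0, 1, 4], [0, 3, 4], [0, 5, 13],
   [0, 8, 13], [0, 1, 2, 10], [0, 8, 9, 10], [0, 2, 5, 14], [0, 3, 12, 13], [0, 6, 9], [0, 5, 9],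
   [0, 3, 9], [0, 4, 5], [0, 7, 8], [0, 2, 8, 14], [0, 4, 10], [0, 1, 9, 13], [0, 4, 12, 13],
   [0, 6, 10], [0, 1, 5], [0, 4, 6], [0, 5, 6, 10], [0, 4, 11], [0, 4, 7], [0, 4, 9], [0, 7, 11],
   [0, 3, 11, 13], [0, 4, 8, 14], [0, 4, 8, 9], [0, 3, 11, 12], [0, 2, 5, 8], [0, 3, 4, 13],
   [0, 3, 8, 15], [0, 7, 11, 12], [0, 1, 3, 9], [0, 1, 5, 9], [0, 6, 7, 8], [0, 7, 8, 10],
   [0, 1, 8, 14], [0, 4, 8], [0, 1, 2, 5], [0, 3, 6, 8], [0, 1, 9, 11], [0, 2, 9, 10],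
   [0, 4, 7, 12], [0, 4, 9, 10], [0, 7, 12, 15], [0, 6, 8, 9], [0, 7, 14, 15], [0, 1, 4, 12],
   [0, 4, 5, 8], [0, 4, 5, 10], [0, 2, 5, 13], [0, 4, 8, 13], [0, 10, 11, 12], [0, 2, 3, 12],
   [0, 4, 6, 7], [0, 1, 9, 12], [0, 1, 3, 11], [0, 2, 8, 10], [0, 6, 9, 12], [0, 6, 8, 15],
   [0, 2, 5, 10], [0, 2, 8, 11], [0, 4, 5, 11], [0, 4, 5, 12], [0, 7, 15], [0, 3, 7, 12],
   [0, 6, 11, 12], [0, 3, 7, 15], [0, 2, 6, 14], [0, 3, 6], [0, 2, 10, 15], [0, 4, 6, 11],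
   [0, 7, 10], [0, 5, 11], [0, 3, 6, 7], [0, 2, 7], [0, 1, 8], [0, 5, 12],
   [0, 1, 2, 3, 5, 14, 17], [0, 1, 2, 3, 9, 12, 21]]

theorem borderedWords_spec : ∀ a ∈ borderedWords, a ≠ [] ∧ a.Nodup ∧ ∀ i ∈ a, i < 23 := by
  decide +kernel

theorem search_borderedWords : ∀ bs : List Bool, bs.length = 2 →
    search (fun w => 12 - (w + w % 2)) (fun w => 12 + (w + w % 2)) false borderedWords 18
      (true :: false :: bs) = true
  | [b₁, b₂], _ => by
    cases b₁ <;> cases b₂ <;> decide +kernel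

section Border

variable {m : ℕ} (α : ZMod 2) (R : Matrix (Fin m) (Fin m) (ZMod 2))

@[simp] theorem borderMat_zero_zero : borderMat α R 0 0 = α := by simp [borderMat]

@[simp] theorem borderMat_zero_succ (j : Fin m) : borderMat α R 0 j.succ = 1 := by
  simp [borderMat]

@[simp] theorem borderMat_succ_zero (i : Fin m) : borderMat α R i.succ 0 = 1 := by
  simp [borderMat]

@[simp] theorem borderMat_succ_succ (i j : Fin m) : borderMat α R i.succ j.succ = R i j := by
  simp [borderMat]

theorem wt_succ (x : Fin (m + 1) → ZMod 2) :
    wt x = (if x 0 ≠ 0 then 1 else 0) + wt fun j : Fin m => x j.succ := by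
  rw [wt_eq_sum, wt_eq_sum, Fin.sum_univ_succ]

theorem wt_one_add (x : Fin m → ZMod 2) : (wt fun j => 1 + x j) + wt x = m := by
  have h : ∀ y : ZMod 2, ((if 1 + y ≠ 0 then 1 else 0) + if y ≠ 0 then 1 else 0) = 1 := by decide
  rw [wt_eq_sum, wt_eq_sum, ← Finset.sum_add_distrib]
  simp only [h]
  simp

theorem ite_natCast_ne_zero (k : ℕ) : (if (k : ZMod 2) ≠ 0 then 1 else 0) = k % 2 := by
  simp only [ne_eq, ZMod.natCast_eq_zero_iff]
  split_ifs <;> omega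

theorem wt_sum_borderMat (S : Finset (Fin m)) :
    (wt fun j => ∑ i ∈ S.map (Fin.succEmb m), borderMat α R i j) =
      S.card % 2 + wt fun j => ∑ i ∈ S, R i j := by
  rw [wt_succ]
  simp [← ite_natCast_ne_zero]

theorem wt_sum_borderMat_zero (S : Finset (Fin m)) :
    (wt fun j => ∑ i ∈ insert 0 (S.map (Fin.succEmb m)), borderMat 0 R i j) +
      (wt fun j => ∑ i ∈ S, R i j) = S.card % 2 + m := by
  have h := wt_one_add fun j => ∑ i ∈ S, R i j
  have h0 : (0 : Fin (m + 1)) ∉ S.map (Fin.succEmb m) := by simp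
  rw [wt_succ, add_assoc]
  simp only [Finset.sum_insert h0, Finset.sum_map, Fin.coe_succEmb, borderMat_zero_zero,
    borderMat_zero_succ, borderMat_succ_zero, borderMat_succ_succ, h, zero_add,
    Finset.sum_const, nsmul_one, ite_natCast_ne_zero]

end Border

theorem isSelfDual_bordered {α : ZMod 2} {R : Matrix (Fin 23) (Fin 23) (ZMod 2)}
    (hR : IsCirculant R) (he : IsEvenCode (rowSpan (genMat (borderMat α R))))
    (hd : ∀ c ∈ rowSpan (genMat (borderMat α R)), c ≠ 0 → 12 ≤ wt c) :
    IsSelfDual (rowSpan (genMat (borderMat α R))) := by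
  obtain rfl : α = 0 := by
    have h := sum_eq_zero_of_isEvenCode he (genMat_mem _ 0)
    rw [sum_genMat, Fin.sum_univ_succ] at h
    simp only [borderMat_zero_zero, borderMat_zero_succ] at h
    have h1 : ∀ x : ZMod 2, 1 + (x + ∑ _ : Fin 23, 1) = 0 → x = 0 := by decide
    exact h1 α h
  have hsum : ∑ j, R 0 j = 0 := by
    have h := sum_eq_zero_of_isEvenCode he (genMat_mem _ (Fin.succ 0))
    rw [sum_genMat, Fin.sum_univ_succ] at h
    simp only [borderMat_succ_zero, borderMat_succ_succ] at h
    rwa [← add_assoc, CharTwo.add_self_eq_zero, zero_add] at h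
  have hwt : ∀ a ∈ borderedWords,
      12 - (a.length + a.length % 2) ≤ wt (shiftSum (R 0) a) ∧
      wt (shiftSum (R 0) a) ≤ 12 + (a.length + a.length % 2) := by
    intro a ha
    obtain ⟨hne, hnd, hlt⟩ := borderedWords_spec a ha
    obtain ⟨S, hS, hSR⟩ := exists_finset_shiftSum hnd hlt
    have hpos : 0 < S.card := hS ▸ List.length_pos_iff.2 hne
    have hS' : (S.map (Fin.succEmb 23)).Nonempty := by simpa using Finset.card_pos.1 hpos
    have h0 : (0 : Fin 24) ∉ S.map (Fin.succEmb 23) := by simp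
    obtain ⟨c, hc, hc0, hcw⟩ := exists_mem_wt_eq (borderMat 0 R) hS'
    obtain ⟨c', hc', hc0', hcw'⟩ := exists_mem_wt_eq (borderMat 0 R)
      (Finset.insert_nonempty 0 (S.map (Fin.succEmb 23)))
    have h12 := hd c hc hc0
    have h12' := hd c' hc' hc0'
    have hz := wt_sum_borderMat_zero R S
    rw [wt_sum_borderMat, Finset.card_map] at hcw
    rw [Finset.card_insert_of_notMem h0, Finset.card_map] at hcw'
    have hw : (wt fun j => ∑ i ∈ S, R i j) = wt (shiftSum (R 0) a) := by simp only [hSR R hR]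
    rw [hw, hS] at hcw hz
    rw [hS] at hcw'
    omega
  have h0 : ∃ j, R 0 j ≠ 0 := by
    by_contra! h
    have h10 := (hwt [0] (by decide)).1
    have : shiftSum (R 0) [0] = 0 := by funext j; simp [shiftSum, h]
    rw [this] at h10
    simp [wt] at h10
  have h1 : ∃ j, R 0 j ≠ 1 := by
    by_contra! h
    simp only [h] at hsum
    revert hsum
    decide
  refine isSelfDual_of_mul_transpose_eq_one ?_
  ext i k
  rw [Matrix.mul_apply, Matrix.one_apply, Fin.sum_univ_succ]
  simp only [Matrix.transpose_apply]
  refine Fin.cases ?_ (fun i => ?_) i <;> refine Fin.cases ?_ (fun k => ?_) k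
  · simp only [borderMat_zero_zero, borderMat_zero_succ]
    decide
  · simp [(Fin.succ_ne_zero k).symm, sum_circulant hR, hsum]
  · simp [sum_circulant hR, hsum]
  · simp only [borderMat_succ_zero, borderMat_succ_succ, Fin.succ_inj, mul_one]
    rw [sum_mul_circulant hR]
    by_cases hik : i = k
    · simp [hik, sum_mul_self, hsum]
    · rw [if_neg hik, autocorr_eq_of_forall_search (by norm_num) (by norm_num)
        search_borderedWords h0 h1 (by simpa using hsum)
        (fun a ha => ⟨(borderedWords_spec a ha).1, (borderedWords_spec a ha).2.2⟩) hwt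
        (sub_ne_zero.2 hik)]
      decide

end DoubleCirculant

open DoubleCirculant in
/-- Every double circulant even code of length 48 which is not self-dual
has minimum weight at most 10. -/
theorem stmt_11 (C : Submodule (ZMod 2) (Fin (23 + 1) ⊕ Fin (23 + 1) → ZMod 2))
    (hdc : IsDC C) (he : IsEvenCode C) (hnsd : ¬ IsSelfDual C) :
    ∀ d, HasMinWt C d → d ≤ 10 := by
  intro d hmin
  by_contra! hlt
  obtain ⟨⟨c, hc, -, hcd⟩, hall⟩ := hmin
  have h12 : 12 ≤ d := by
    have := he c hc
    omega
  have hd : ∀ c ∈ C, c ≠ 0 → 12 ≤ wt c := fun c hc h0 => h12.trans (hall c hc h0)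
  rcases hdc with ⟨R, hR, rfl⟩ | ⟨α, R, hR, rfl⟩
  · exact hnsd (isSelfDual_pure hR he hd)
  · exact hnsd (isSelfDual_bordered hR he hd)
end

section
/- Let C be an even binary [32,16] code with minimum weight at least 8 whose weight distribution equals the weight distribution of its dual code C^⊥ (i.e., C is formally self-dual). Then A_10(C) = 4960 − 8·A_8(C), A_12(C) = −3472 + 28·A_8(C), and A_14(C) = 34720 − 56·A_8(C). -/
/-- The nontrivial additive character of `ZMod 2`, with integer values. -/
def signChar (a : ZMod 2) : ℤ := if a = 0 then 1 else -1

@[simp] theorem signChar_zero : signChar 0 = 1 := rfl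

theorem signChar_add : ∀ a b : ZMod 2, signChar (a + b) = signChar a * signChar b := by
  decide

theorem signChar_sum {ι : Type*} (s : Finset ι) (f : ι → ZMod 2) :
    signChar (∑ i ∈ s, f i) = ∏ i ∈ s, signChar (f i) := by
  classical
  induction s using Finset.induction_on with
  | empty => simp
  | insert a s ha ih => rw [Finset.sum_insert ha, Finset.prod_insert ha, signChar_add, ih]

section MacWilliams

variable {ι : Type*} [Fintype ι]

open Classical in
theorem sum_signChar_dot (C : Submodule (ZMod 2) (ι → ZMod 2)) (v : ι → ZMod 2) :
    ∑ c ∈ Finset.univ.filter (· ∈ C), signChar (∑ i, v i * c i) =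
      if v ∈ dualCode C then (Nat.card C : ℤ) else 0 := by
  split_ifs with hv
  · rw [Finset.sum_congr rfl (g := fun _ => (1 : ℤ))]
    · simp [Nat.card_eq_fintype_card, Fintype.card_subtype]
    · intro c hc
      rw [hv c (by simpa using hc), signChar_zero]
  · obtain ⟨d, hd, hvd⟩ : ∃ d ∈ C, ∑ i, v i * d i ≠ 0 := by
      by_contra! h
      exact hv h
    have hneg : signChar (∑ i, v i * d i) = -1 := if_neg hvd
    have htrans : ∑ c ∈ Finset.univ.filter (· ∈ C), signChar (∑ i, v i * c i) =
        ∑ c ∈ Finset.univ.filter (· ∈ C), -signChar (∑ i, v i * c i) := by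
      refine Finset.sum_equiv (Equiv.addRight (-d)) ?_ ?_
      · intro c
        simpa [← sub_eq_add_neg] using (Submodule.sub_mem_iff_left C hd).symm
      · intro c _
        have hsplit : ∑ i, v i * c i =
            ∑ i, v i * (Equiv.addRight (-d) c) i + ∑ i, v i * d i := by
          rw [← Finset.sum_add_distrib]
          refine Finset.sum_congr rfl fun i _ => ?_
          simp only [Equiv.coe_addRight, Pi.add_apply, Pi.neg_apply]
          ring
        rw [hsplit, signChar_add, hneg]
        ring
    rw [Finset.sum_neg_distrib] at htrans
    linarith

theorem pow_wt (y : ℤ) (v : ι → ZMod 2) :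
    y ^ wt v = ∏ i, if v i = 0 then 1 else y := by
  simp [wt, Finset.prod_ite]

theorem sum_pow_wt_mul_signChar [DecidableEq ι] (y : ℤ) (c : ι → ZMod 2) :
    ∑ v : ι → ZMod 2, y ^ wt v * signChar (∑ i, v i * c i) =
      (1 + y) ^ (Fintype.card ι - wt c) * (1 - y) ^ wt c := by
  have hfactor : ∀ v : ι → ZMod 2, y ^ wt v * signChar (∑ i, v i * c i) =
      ∏ i, (if v i = 0 then 1 else y) * signChar (v i * c i) := fun v => by
    rw [pow_wt, signChar_sum, Finset.prod_mul_distrib]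
  have hlocal : ∀ a : ZMod 2, ∑ b : ZMod 2, (if b = 0 then 1 else y) * signChar (b * a) =
      if a = 0 then 1 + y else 1 - y := by
    intro a
    change ∑ b : Fin 2, _ = _
    rw [Fin.sum_univ_two]
    fin_cases a
    · change (if (0 : ZMod 2) = 0 then (1 : ℤ) else y) * signChar 0 +
        (if (1 : ZMod 2) = 0 then 1 else y) * signChar 0 = 1 + y
      simp
    · change (if (0 : ZMod 2) = 0 then (1 : ℤ) else y) * 1 +
        (if (1 : ZMod 2) = 0 then 1 else y) * (-1) = 1 - y
      simp [sub_eq_add_neg]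
  have hcard : (Finset.univ.filter fun i => c i = 0).card = Fintype.card ι - wt c := by
    have h := Finset.card_filter_add_card_filter_not (s := Finset.univ) (fun i => c i = 0)
    rw [Finset.card_univ] at h
    simp only [wt, ne_eq]
    omega
  rw [Finset.sum_congr rfl fun v _ => hfactor v, ← Fintype.piFinset_univ,
    ← Finset.prod_univ_sum (fun _ => Finset.univ)
      (fun i b => (if b = 0 then 1 else y) * signChar (b * c i)),
    Finset.prod_congr rfl fun i _ => hlocal (c i), Finset.prod_ite, Finset.prod_const,
    Finset.prod_const, hcard]
  rfl

theorem wt_le_card (v : ι → ZMod 2) : wt v ≤ Fintype.card ι :=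
  Finset.card_le_univ _

open Classical in
theorem sum_code_eq_sum_Awt (C : Submodule (ZMod 2) (ι → ZMod 2)) (g : ℕ → ℤ) :
    ∑ c ∈ Finset.univ.filter (· ∈ C), g (wt c) =
      ∑ i ∈ Finset.range (Fintype.card ι + 1), Awt C i * g i := by
  rw [← Finset.sum_fiberwise_of_maps_to (t := Finset.range (Fintype.card ι + 1)) (g := wt)
    fun c _ => Finset.mem_range_succ_iff.2 (wt_le_card c)]
  refine Finset.sum_congr rfl fun i _ => ?_
  have hAwt : Awt C i = ((Finset.univ.filter (· ∈ C)).filter fun c => wt c = i).card := by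
    rw [Awt, ← Set.ncard_coe_finset]
    congr 1
    ext c
    simp
  rw [hAwt, Finset.sum_congr rfl (g := fun _ => g i)]
  · simp
  · intro c hc
    rw [(Finset.mem_filter.1 hc).2]

/-- The MacWilliams identity, evaluated at an integer. -/
theorem macWilliams (C : Submodule (ZMod 2) (ι → ZMod 2)) (y : ℤ) :
    (Nat.card C : ℤ) * ∑ i ∈ Finset.range (Fintype.card ι + 1), Awt (dualCode C) i * y ^ i =
      ∑ i ∈ Finset.range (Fintype.card ι + 1),
        Awt C i * ((1 + y) ^ (Fintype.card ι - i) * (1 - y) ^ i) := by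
  classical
  rw [← sum_code_eq_sum_Awt C fun i => (1 + y) ^ (Fintype.card ι - i) * (1 - y) ^ i,
    ← sum_code_eq_sum_Awt (dualCode C) fun i => y ^ i]
  simp_rw [← sum_pow_wt_mul_signChar]
  rw [Finset.sum_comm]
  simp_rw [← Finset.mul_sum, sum_signChar_dot]
  rw [Finset.sum_filter, Finset.mul_sum]
  refine Finset.sum_congr rfl fun v _ => ?_
  split_ifs <;> ring

theorem Awt_zero (C : Submodule (ZMod 2) (ι → ZMod 2)) : Awt C 0 = 1 := by
  rw [Awt, Set.ncard_eq_one]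
  refine ⟨0, Set.ext fun c => ?_⟩
  simp only [wt, Finset.card_eq_zero, Finset.filter_eq_empty_iff, Set.mem_ofPred_eq,
    Set.mem_singleton_iff, SetLike.mem_coe]
  constructor
  · rintro ⟨-, h⟩
    funext i
    simpa using h (Finset.mem_univ i)
  · rintro rfl
    simp

theorem Awt_eq_zero {C : Submodule (ZMod 2) (ι → ZMod 2)} {i : ℕ}
    (h : ∀ c ∈ C, wt c ≠ i) : Awt C i = 0 := by
  rw [Awt, Set.ncard_eq_zero]
  exact Set.eq_empty_iff_forall_notMem.2 fun c hc => h c hc.1 hc.2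

end MacWilliams

/-- The weight enumerator constraints for a formally self-dual even
`[32, 16]` code with minimum weight at least 8. -/
theorem stmt_13 (C : Submodule (ZMod 2) (Fin 32 → ZMod 2))
    (hdim : Module.finrank (ZMod 2) C = 16) (he : IsEvenCode C)
    (hmin : ∀ c ∈ C, c ≠ 0 → 8 ≤ wt c)
    (hfsd : ∀ i, Awt C i = Awt (dualCode C) i) :
    (Awt C 10 : ℤ) = 4960 - 8 * (Awt C 8 : ℤ) ∧
    (Awt C 12 : ℤ) = -3472 + 28 * (Awt C 8 : ℤ) ∧
    (Awt C 14 : ℤ) = 34720 - 56 * (Awt C 8 : ℤ) := by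
  have hcard : Nat.card C = 2 ^ 16 := by
    rw [Module.natCard_eq_pow_finrank (K := ZMod 2), hdim, Nat.card_zmod]
  have hodd : ∀ i, i % 2 = 1 → Awt C i = 0 := fun i hi => Awt_eq_zero fun c hc h => by
    have := he c hc
    omega
  have hsmall : ∀ i, 0 < i → i < 8 → Awt C i = 0 := fun i hpos hlt =>
    Awt_eq_zero fun c hc h => by
      by_cases hc0 : c = 0
      · subst hc0
        simp [wt] at h
        omega
      · have := hmin c hc hc0
        omega
  have hvalues : ∀ y : ℤ, (2 : ℤ) ^ 16 * (1 + ∑ k ∈ Finset.range 13,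
        (Awt C (2 * k + 8) : ℤ) * y ^ (2 * k + 8)) =
      (1 + y) ^ 32 + ∑ k ∈ Finset.range 13,
        (Awt C (2 * k + 8) : ℤ) * ((1 + y) ^ (24 - 2 * k) * (1 - y) ^ (2 * k + 8)) := by
    intro y
    have h := macWilliams C y
    simp only [← hfsd, hcard, Fintype.card_fin] at h
    simpa [Finset.sum_range_succ, Awt_zero, hsmall, hodd, add_assoc] using h
  simp only [Finset.sum_range_succ, Finset.sum_range_zero] at hvalues
  -- These twelve evaluations determine all `A_i` in terms of `A_8`.
  have h_0 := hvalues 0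
  have h_neg1 := hvalues (-1)
  have h_2 := hvalues 2
  have h_neg2 := hvalues (-2)
  have h_3 := hvalues 3
  have h_4 := hvalues 4
  have h_neg4 := hvalues (-4)
  have h_5 := hvalues 5
  have h_neg5 := hvalues (-5)
  have h_6 := hvalues 6
  have h_neg6 := hvalues (-6)
  have h_7 := hvalues 7
  norm_num at h_0 h_neg1 h_2 h_neg2 h_3 h_4 h_neg4 h_5 h_neg5 h_6 h_neg6 h_7
  refine ⟨?_, ?_, ?_⟩ <;> linarith
end
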